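/- Let N ⊆ M be an inclusion of II₁ factors with N' ∩ M = ℂ1. Then a corner of M embeds into N inside M (M ≺_M N) if and only if the Jones index [M : N] is finite. -/

import Mathlib

open scoped ComplexOrder
open Filter

namespace PopaQ

variable {H : Type u} [NormedAddCommGroup H] [InnerProductSpace ℂ H] [CompleteSpace H]

/-- Bounded operators on `H`. -/
abbrev Op (H : Type u) [NormedAddCommGroup H] [InnerProductSpace ℂ H] [CompleteSpace H] :=
  H →L[ℂ] H

/-- The relative commutant `N' ∩ M` (as sets of operators). -/
def relComm (N M : Set (Op H)) : Set (Op H) :=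
  {x | x ∈ M ∧ ∀ y ∈ N, y * x = x * y}

/-- The scalar operators `ℂ 1`. -/
def scalars (H : Type u) [NormedAddCommGroup H] [InnerProductSpace ℂ H] [CompleteSpace H] :
    Set (Op H) :=
  {x | ∃ c : ℂ, x = c • (1 : Op H)}

/-- A (self-adjoint) projection. -/
def IsProjection (p : Op H) : Prop :=
  IsSelfAdjoint p ∧ IsIdempotentElem p

/-- `τ` is a faithful tracial state on `M`. -/
structure IsTracialState (M : Set (Op H)) (τ : Op H →ₗ[ℂ] ℂ) : Prop where
  map_one : τ 1 = 1
  tracial : ∀ x ∈ M, ∀ y ∈ M, τ (x * y) = τ (y * x)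
  pos : ∀ x ∈ M, 0 ≤ τ (star x * x)
  faithful : ∀ x ∈ M, τ (star x * x) = 0 → x = 0

/-- A set of operators is finite dimensional as a complex vector space. -/
def FinDim (S : Set (Op H)) : Prop :=
  ∃ s : Finset (Op H), S ⊆ (Submodule.span ℂ (s : Set (Op H)) : Set (Op H))

/-- `M` is a II₁ factor with faithful normal trace `τ`:
a factor (trivial center) carrying a faithful tracial state, which is
infinite dimensional. -/
structure IsII1Factor (M : VonNeumannAlgebra H) (τ : Op H →ₗ[ℂ] ℂ) : Prop where
  factor : relComm (M : Set (Op H)) (M : Set (Op H)) = scalars H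
  trace : IsTracialState (M : Set (Op H)) τ
  infdim : ¬ FinDim (M : Set (Op H))

/-- `M` is hyperfinite: it is the (weak closure = double commutant) of an increasing
union of finite-dimensional *-subalgebras. -/
def IsHyperfinite (M : VonNeumannAlgebra H) : Prop :=
  ∃ A : ℕ → StarSubalgebra ℂ (Op H),
    Monotone A ∧ (∀ n, (A n : Set (Op H)) ⊆ M) ∧ (∀ n, FinDim (A n : Set (Op H))) ∧
    Set.centralizer (Set.centralizer (⋃ n, (A n : Set (Op H)))) = (M : Set (Op H))

/-- A bounded sequence of operators. -/
def Bdd (x : ℕ → Op H) : Prop :=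
  ∃ C : ℝ, ∀ n, ‖x n‖ ≤ C

/-- A sequence taking values in `S`. -/
def SeqIn (S : Set (Op H)) (x : ℕ → Op H) : Prop :=
  ∀ n, x n ∈ S

/-- A free ultrafilter on ℕ. -/
def IsFreeUltrafilter (ω : Ultrafilter ℕ) : Prop :=
  ∀ s : Set ℕ, s.Finite → s ∉ ω

/-- `Mω` is the tracial ultrapower of `M` along `ω`, with trace `τ`;
`limω` assigns to each bounded sequence in `M` its class in `Mω` (the diagonal
embedding of `M` into `Mω` being the identity on `M`). -/
structure IsTracialUltrapower (ω : Ultrafilter ℕ) (M Mω : VonNeumannAlgebra H)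
    (τ : Op H →ₗ[ℂ] ℂ) (limω : (ℕ → Op H) → Op H) : Prop where
  subset : (M : Set (Op H)) ⊆ (Mω : Set (Op H))
  mem : ∀ x, SeqIn (M : Set (Op H)) x → Bdd x → limω x ∈ Mω
  diag : ∀ m ∈ M, limω (fun _ => m) = m
  map_add : ∀ x y, SeqIn (M : Set (Op H)) x → Bdd x → SeqIn (M : Set (Op H)) y → Bdd y →
    limω (fun n => x n + y n) = limω x + limω y
  map_mul : ∀ x y, SeqIn (M : Set (Op H)) x → Bdd x → SeqIn (M : Set (Op H)) y → Bdd y →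
    limω (fun n => x n * y n) = limω x * limω y
  map_smul : ∀ (c : ℂ) x, SeqIn (M : Set (Op H)) x → Bdd x →
    limω (fun n => c • x n) = c • limω x
  map_star : ∀ x, SeqIn (M : Set (Op H)) x → Bdd x →
    limω (fun n => star (x n)) = star (limω x)
  surj : ∀ z ∈ Mω, ∃ x, SeqIn (M : Set (Op H)) x ∧ Bdd x ∧ limω x = z
  tr : ∀ x, SeqIn (M : Set (Op H)) x → Bdd x →
    Tendsto (fun n => τ (x n)) (ω : Filter ℕ) (nhds (τ (limω x)))
  eq_zero : ∀ x, SeqIn (M : Set (Op H)) x → Bdd x →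
    (limω x = 0 ↔ Tendsto (fun n => ‖τ (star (x n) * x n)‖) (ω : Filter ℕ) (nhds 0))
  traceState : IsTracialState (Mω : Set (Op H)) τ

/-- The ultrapower `N^ω ⊆ M^ω` of a subalgebra `N ⊆ M`: classes of bounded
sequences with entries in `N`. -/
def ultrapowerSet (limω : (ℕ → Op H) → Op H) (N : Set (Op H)) : Set (Op H) :=
  {z | ∃ x, SeqIn N x ∧ Bdd x ∧ limω x = z}

/-- `θ` is a *-homomorphism from `S` to `T` (as sets of operators). -/
def IsStarHomOn (θ : Op H → Op H) (S T : Set (Op H)) : Prop :=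
  (∀ x ∈ S, θ x ∈ T) ∧
  (∀ x ∈ S, ∀ y ∈ S, θ (x + y) = θ x + θ y) ∧
  (∀ x ∈ S, ∀ y ∈ S, θ (x * y) = θ x * θ y) ∧
  (∀ (c : ℂ), ∀ x ∈ S, θ (c • x) = c • θ x) ∧
  (∀ x ∈ S, θ (star x) = star (θ x))

/-- The corner `p S p` of a set of operators. -/
def corner (p : Op H) (S : Set (Op H)) : Set (Op H) :=
  {x | x ∈ S ∧ p * x * p = x}

/-- Popa's intertwining relation: a corner of `P` embeds into `Q` inside `M`,
written `P ≺_M Q`: there are nonzero projections `p ∈ P`, `q ∈ Q`, a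
*-homomorphism `θ : pPp → qQq` and a nonzero partial isometry `v ∈ qMp` with
`θ(x) v = v x` for all `x ∈ pPp`. -/
def CornerEmbeds (P Q M : Set (Op H)) : Prop :=
  ∃ (p q v : Op H) (θ : Op H → Op H),
    p ∈ P ∧ IsProjection p ∧ p ≠ 0 ∧
    q ∈ Q ∧ IsProjection q ∧ q ≠ 0 ∧
    IsStarHomOn θ (corner p P) (corner q Q) ∧
    v ∈ M ∧ v ≠ 0 ∧ IsProjection (star v * v) ∧ q * v * p = v ∧
    ∀ x ∈ corner p P, θ x * v = v * x

/-- `E` is the (`τ`-preserving) conditional expectation from `M` onto `Q`. -/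
structure IsCondExp (τ : Op H →ₗ[ℂ] ℂ) (M Q : Set (Op H)) (E : Op H → Op H) : Prop where
  mem : ∀ x ∈ M, E x ∈ Q
  fix : ∀ q ∈ Q, E q = q
  map_add : ∀ x ∈ M, ∀ y ∈ M, E (x + y) = E x + E y
  map_smul : ∀ (c : ℂ), ∀ x ∈ M, E (c • x) = c • E x
  bimod : ∀ a ∈ Q, ∀ x ∈ M, ∀ b ∈ Q, E (a * x * b) = a * E x * b
  tr : ∀ x ∈ M, τ (E x) = τ x

/-- `c` is a Pimsner–Popa bound for the inclusion `Q ⊆ M` with conditional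
expectation `E`: every positive `x ∈ M` satisfies `x ≤ c E(x)`. -/
def IndexBound (M : Set (Op H)) (E : Op H → Op H) (c : ℝ) : Prop :=
  ∀ x ∈ M, x.IsPositive → (c • E x - x).IsPositive

/-- The inclusion `Q ⊆ M` (with conditional expectation `E`) has finite Jones index. -/
def HasFiniteIndex (M : Set (Op H)) (E : Op H → Op H) : Prop :=
  ∃ c : ℝ, 0 < c ∧ IndexBound M E c

/-- The Jones index `[M : Q]` of an inclusion `Q ⊆ M` with conditional expectation `E`,
via the Pimsner–Popa characterization as the optimal constant `c` with
`x ≤ c E(x)` for all positive `x ∈ M`. -/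
noncomputable def jonesIndex (M : Set (Op H)) (E : Op H → Op H) : ℝ :=
  sInf {c : ℝ | 0 < c ∧ IndexBound M E c}


/-! ### Basics -/

lemma starProj_comm (K : Submodule ℂ H) [K.HasOrthogonalProjection] (c : Op H)
    (h1 : ∀ ξ ∈ K, c ξ ∈ K) (h2 : ∀ ξ ∈ K, (star c) ξ ∈ K) :
    K.starProjection * c = c * K.starProjection := by
  ext ξ
  have hk : K.starProjection ξ ∈ K := Submodule.starProjection_apply_mem K ξ
  have ho : ξ - K.starProjection ξ ∈ Kᗮ := Submodule.sub_starProjection_mem_orthogonal ξ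
  have ho' : c (ξ - K.starProjection ξ) ∈ Kᗮ := by
    rw [Submodule.mem_orthogonal] at ho ⊢
    intro u hu
    have := ho _ (h2 u hu)
    rwa [ContinuousLinearMap.star_eq_adjoint, ContinuousLinearMap.adjoint_inner_left] at this
  show K.starProjection (c ξ) = c (K.starProjection ξ)
  apply Submodule.eq_starProjection_of_mem_orthogonal
  · exact h1 _ hk
  · simpa using ho'

lemma mem_of_comm (N : VonNeumannAlgebra H) (x : Op H)
    (h : ∀ c ∈ N.commutant, c * x = x * c) : x ∈ N := by
  rw [← N.commutant_commutant, VonNeumannAlgebra.mem_commutant_iff]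
  exact h

lemma smul_mem' (N : VonNeumannAlgebra H) {x : Op H} (c : ℂ) (h : x ∈ N) : c • x ∈ N :=
  N.toStarSubalgebra.smul_mem h c

lemma rsmul_mem' (N : VonNeumannAlgebra H) {x : Op H} (c : ℝ) (h : x ∈ N) : c • x ∈ N := by
  have := smul_mem' N (c : ℂ) h
  simpa using this

lemma cfc_mem (N : VonNeumannAlgebra H) {a : Op H} (ha : a ∈ N) (f : ℝ → ℝ) : cfc f a ∈ N := by
  apply mem_of_comm
  intro c hc
  have h : Commute a c := VonNeumannAlgebra.mem_commutant_iff.1 hc a ha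
  exact (h.cfc_real f).symm

/-- projection on the kernel -/
noncomputable def kerProj (b : Op H) : Op H := (LinearMap.ker b.toLinearMap).starProjection

instance kerInst (b : Op H) : (LinearMap.ker b.toLinearMap).HasOrthogonalProjection := by
  have : CompleteSpace (LinearMap.ker b.toLinearMap) := by
    exact ContinuousLinearMap.completeSpace_ker b
  infer_instance

lemma kerProj_proj (b : Op H) : IsProjection (kerProj b) :=
  ⟨isSelfAdjoint_starProjection _, Submodule.isIdempotentElem_starProjection _⟩

lemma mul_kerProj (b : Op H) : b * kerProj b = 0 := by
  ext ξ
  exact Submodule.starProjection_apply_mem (LinearMap.ker b.toLinearMap) ξ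

lemma kerProj_mul (b c : Op H) (h : b * c = 0) : kerProj b * c = c := by
  ext ξ
  apply Submodule.starProjection_eq_self_iff.2
  exact congrArg (fun T : Op H => T ξ) h

lemma kerProj_comm (b c : Op H) (hb : IsSelfAdjoint b) (h : c * b = b * c) :
    c * kerProj b = kerProj b * c := by
  symm
  apply starProj_comm
  · intro ξ hξ
    have h1 : b ξ = 0 := hξ
    show b (c ξ) = 0
    have := congrArg (fun T : Op H => T ξ) h
    simp [h1] at this
    exact this.symm
  · intro ξ hξ
    have h1 : b ξ = 0 := hξ
    show b (star c ξ) = 0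
    have h' : b * star c = star c * b := by
      have := congrArg star h
      simpa [hb.star_eq] using this
    have := congrArg (fun T : Op H => T ξ) h'
    simp [h1] at this
    exact this

lemma factor_ne (N : VonNeumannAlgebra H)
    (hf : relComm (N : Set (Op H)) (N : Set (Op H)) = scalars H) {a b : Op H}
    (ha : a ∈ N) (_hb : b ∈ N) (ha0 : a ≠ 0) (hb0 : b ≠ 0) : ∃ n ∈ N, a * n * b ≠ 0 := by
  by_contra hcon
  push Not at hcon
  let K : Submodule ℂ H := ⨅ n : N, LinearMap.ker (a * (n : Op H)).toLinearMap
  have memK : ∀ ξ, ξ ∈ K ↔ ∀ n ∈ N, a (n ξ) = 0 := by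
    intro ξ
    simp only [K, Submodule.mem_iInf, Subtype.forall]
    rfl
  have hKc : IsClosed (K : Set H) := by
    simp only [K, Submodule.coe_iInf]
    exact isClosed_iInter fun n => ContinuousLinearMap.isClosed_ker (a * (n : Op H))
  have : CompleteSpace K := hKc.completeSpace_coe
  have i1 : ∀ c ∈ N, ∀ ξ ∈ K, c ξ ∈ K := by
    intro c hc ξ hξ
    rw [memK] at hξ ⊢
    intro n hn
    exact hξ (n * c) (mul_mem hn hc)
  have i2 : ∀ c ∈ N.commutant, ∀ ξ ∈ K, c ξ ∈ K := by
    intro c hc ξ hξ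
    rw [memK] at hξ ⊢
    intro n hn
    have h := VonNeumannAlgebra.mem_commutant_iff.1 hc (a * n) (mul_mem ha hn)
    have := congrArg (fun T : Op H => T ξ) h
    simp [hξ n hn] at this
    exact this
  have hP : K.starProjection ∈ relComm (N : Set (Op H)) (N : Set (Op H)) := by
    refine ⟨mem_of_comm N _ fun c hc => ?_, fun c hc => ?_⟩
    · exact (starProj_comm K c (i2 c hc) (i2 _ (star_mem hc))).symm
    · exact (starProj_comm K c (i1 c hc) (i1 _ (star_mem (s := N) hc))).symm
  rw [hf] at hP
  obtain ⟨c, hc⟩ := hP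
  have hPb : K.starProjection * b = b := by
    ext ξ
    apply Submodule.starProjection_eq_self_iff.2
    rw [memK]
    intro n hn
    exact congrArg (fun T : Op H => T ξ) (hcon n hn)
  rw [hc] at hPb
  have hc1 : c = 1 := by
    have : (c - 1) • b = 0 := by
      rw [sub_smul, one_smul, sub_eq_zero]; simpa using hPb
    rcases smul_eq_zero.1 this with h | h
    · exact sub_eq_zero.1 h
    · exact absurd h hb0
  apply ha0
  ext ξ
  have : ξ ∈ K := by
    have h2 : K.starProjection ξ = ξ := by rw [hc, hc1]; simp
    exact Submodule.starProjection_eq_self_iff.1 h2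
  have := (memK ξ).1 this 1 (one_mem N)
  simpa using this

lemma inner_mono {a b : Op H} (h : a ≤ b) (ξ : H) :
    (inner ℂ (a ξ) ξ).re ≤ (inner ℂ (b ξ) ξ).re := by
  have h1 := ((ContinuousLinearMap.le_def a b).1 h).re_inner_nonneg_left ξ
  simp [inner_sub_left] at h1
  exact h1

lemma inner_algMap (δ : ℝ) (ξ : H) :
    (inner ℂ ((algebraMap ℝ (Op H) δ) ξ) ξ).re = δ * ‖ξ‖ ^ 2 := by
  have : (algebraMap ℝ (Op H) δ) ξ = (δ : ℂ) • ξ := by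
    rw [Algebra.algebraMap_eq_smul_one]; simp
  rw [this, inner_smul_left, inner_self_eq_norm_sq_to_K]
  simp only [Complex.conj_ofReal, Complex.re_ofReal_mul]
  congr 1
  norm_cast

/-- Normalization lemma / spectral cut. -/
lemma norm_lemma (a : Op H) (ha : 0 ≤ a) (δ : ℝ) (hδ : 0 < δ) :
    ∃ f s : Op H, IsProjection f ∧ IsSelfAdjoint s ∧ s * a = a * s ∧ s * a * s = f ∧
      s * f = s ∧ f * s = s ∧
      (∀ ξ, (inner ℂ (a (ξ - f ξ)) (ξ - f ξ)).re ≤ δ * ‖ξ - f ξ‖ ^ 2) ∧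
      (∀ ξ, δ * ‖f ξ‖ ^ 2 ≤ (inner ℂ (a (f ξ)) (f ξ)).re) ∧
      (∀ c : Op H, c * a = a * c → c * f = f * c) ∧
      (∀ c : Op H, c * a = a * c → c * s = s * c) := by
  have hsa : IsSelfAdjoint a := IsSelfAdjoint.of_nonneg ha
  set hp : Op H := cfc (fun t : ℝ => max (t - δ) 0) a with hhp
  set g : Op H := cfc (fun t : ℝ => (Real.sqrt (max t δ))⁻¹) a with hg
  have hgc : Continuous (fun t : ℝ => (Real.sqrt (max t δ))⁻¹) := by
    apply Continuous.inv₀ (by fun_prop)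
    intro t
    have : 0 < max t δ := lt_max_of_lt_right hδ
    exact (Real.sqrt_pos.2 this).ne'
  have hps : IsSelfAdjoint hp := cfc_predicate _ a
  have hgs : IsSelfAdjoint g := cfc_predicate _ a
  have hk := kerProj_proj hp
  set k := kerProj hp with hkdef
  have hpk : hp * k = 0 := mul_kerProj hp
  have hkhp : k * hp = 0 := by
    have := congrArg star hpk
    simpa [hk.1.star_eq, hps.star_eq] using this
  -- commutation
  have cg : ∀ c : Op H, c * a = a * c → c * g = g * c := fun c hc =>
    (Commute.cfc_real (show Commute a c from hc.symm) _).symm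
  have chp : ∀ c : Op H, c * a = a * c → c * hp = hp * c := fun c hc =>
    (Commute.cfc_real (show Commute a c from hc.symm) _).symm
  have ck : ∀ c : Op H, c * a = a * c → c * k = k * c := fun c hc =>
    kerProj_comm hp c hps (chp c hc)
  have cak : a * k = k * a := ck a rfl
  have cga : a * g = g * a := cg a rfl
  have cgk : g * k = k * g := ck g cga.symm
  have key : hp * (g * a * g - 1) = 0 := by
    have e1 : g * a * g = cfc (fun t : ℝ => (Real.sqrt (max t δ))⁻¹ * t * (Real.sqrt (max t δ))⁻¹) a := by
      conv_lhs => rw [show a = cfc (fun t : ℝ => t) a from (cfc_id' ℝ a).symm]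
      rw [hg, cfc_id' ℝ a]
      have c1 : ContinuousOn (fun t : ℝ => (Real.sqrt (max t δ))⁻¹) (spectrum ℝ a) := hgc.continuousOn
      rw [cfc_mul (fun t : ℝ => (Real.sqrt (max t δ))⁻¹ * t) _ a (c1.mul continuousOn_id) c1,
        cfc_mul _ (fun t : ℝ => t) a c1 continuousOn_id, cfc_id' ℝ a]
    have c2 : ContinuousOn (fun t : ℝ => (Real.sqrt (max t δ))⁻¹ * t * (Real.sqrt (max t δ))⁻¹)
        (spectrum ℝ a) := ((hgc.mul continuous_id).mul hgc).continuousOn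
    rw [e1, ← cfc_one ℝ a, ← cfc_sub _ _ a c2 (continuous_one.continuousOn), hhp,
      ← cfc_mul (fun t : ℝ => max (t - δ) 0) (fun x : ℝ => (Real.sqrt (max x δ))⁻¹ * x * (Real.sqrt (max x δ))⁻¹ - (1 : ℝ → ℝ) x) a
        (by fun_prop) (c2.sub (continuous_one.continuousOn))]
    rw [← cfc_zero ℝ a]
    apply cfc_congr
    intro t _
    simp only [Pi.one_apply, Pi.zero_apply]
    rcases le_total t δ with h | h
    · rw [max_eq_right (by linarith)]; simp
    · rw [max_eq_left h]
      have ht : 0 < t := by linarith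
      have : (Real.sqrt t)⁻¹ * t * (Real.sqrt t)⁻¹ = 1 := by
        have h1 := Real.mul_self_sqrt ht.le
        have h2 := (Real.sqrt_pos.2 ht).ne'
        field_simp
        nlinarith
      rw [this]; simp
  have key2 : k * (g * a * g - 1) = g * a * g - 1 := kerProj_mul _ _ key
  refine ⟨1 - k, g * (1 - k), ⟨?_, ?_⟩, ?_, ?_, ?_, ?_, ?_, ?_, ?_, ?_, ?_⟩
  · exact (IsSelfAdjoint.one _).sub hk.1
  · exact hk.2.one_sub
  · rw [IsSelfAdjoint, star_mul, hgs.star_eq, star_sub, hk.1.star_eq, star_one]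
    simp only [mul_sub, sub_mul, mul_one, one_mul, cgk]
  · simp only [mul_sub, sub_mul, mul_one, one_mul]
    rw [← mul_assoc, cga, mul_assoc g k a, ← cak, ← mul_assoc g a k]
  · have : g * (1 - k) * a * (g * (1 - k)) = (1 - k) * (g * a * g) * (1 - k) := by
      have e : g * (1 - k) = (1 - k) * g := by simp only [mul_sub, sub_mul, mul_one, one_mul, cgk]
      nth_rewrite 1 [e]
      simp only [mul_assoc]
    rw [this]
    have : (1 - k) * (g * a * g) = 1 - k := by
      have : (1 - k) * (g * a * g - 1) = 0 := by rw [sub_mul, key2]; simp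
      rw [mul_sub, mul_one] at this
      exact sub_eq_zero.1 this
    rw [this]; exact hk.2.one_sub
  · rw [mul_assoc, hk.2.one_sub.eq]
  · have : g * (1 - k) = (1 - k) * g := by simp only [mul_sub, sub_mul, mul_one, one_mul, cgk]
    rw [this, ← mul_assoc, hk.2.one_sub.eq]
  · intro ξ
    have hle : a ≤ hp + algebraMap ℝ (Op H) δ := by
      have : a = cfc (fun t : ℝ => t) a := (cfc_id' ℝ a).symm
      conv_lhs => rw [this]
      rw [hhp, ← cfc_const (R := ℝ) δ a, ← cfc_add a _ _ (by fun_prop) (by fun_prop)]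
      apply cfc_mono
      · intro t _
        have := le_max_left (t - δ) 0
        linarith
      · exact Continuous.continuousOn (by fun_prop)
      · exact Continuous.continuousOn (by fun_prop)
    have h1 := inner_mono hle (k ξ)
    have h2 : hp (k ξ) = 0 := congrArg (fun T : Op H => T ξ) hpk
    have h3 : ξ - (1 - k) ξ = k ξ := by simp
    rw [h3]
    rwa [add_apply, h2, zero_add, inner_algMap] at h1
  · intro ξ
    set hm : Op H := cfc (fun t : ℝ => max (δ - t) 0) a with hhm
    have hle : algebraMap ℝ (Op H) δ ≤ a + hm := by
      have : a = cfc (fun t : ℝ => t) a := (cfc_id' ℝ a).symm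
      have e2 : a + hm = cfc (fun t : ℝ => t) a + hm := by rw [← this]
      rw [e2, hhm]
      rw [← cfc_const (R := ℝ) δ a, ← cfc_add a _ _ (by fun_prop) (by fun_prop)]
      apply cfc_mono
      · intro t _
        have := le_max_left (δ - t) 0
        linarith
      · exact Continuous.continuousOn (by fun_prop)
      · exact Continuous.continuousOn (by fun_prop)
    have hmp : hp * hm = 0 := by
      rw [hhp, hhm, ← cfc_mul _ _ a (by fun_prop) (by fun_prop), ← cfc_zero ℝ a]
      apply cfc_congr
      intro t _
      simp only [Pi.zero_apply]
      rcases le_total t δ with h | h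
      · rw [max_eq_right (by linarith)]; simp
      · rw [max_eq_right (a := δ - t) (by linarith)]; simp
    have h0 : hm * (1 - k) = 0 := by
      have h1 : k * hm = hm := kerProj_mul _ _ hmp
      have hms : IsSelfAdjoint hm := cfc_predicate _ a
      have := congrArg star h1
      simp only [star_mul, hms.star_eq, hk.1.star_eq] at this
      rw [mul_sub, this]; simp
    have h1 := inner_mono hle ((1 - k) ξ)
    have h2 : hm ((1 - k) ξ) = 0 := congrArg (fun T : Op H => T ξ) h0
    rwa [add_apply, h2, add_zero, inner_algMap] at h1
  · intro c hc
    simp only [mul_sub, sub_mul, mul_one, one_mul, ck c hc]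
  · intro c hc
    have e1 := ck c hc
    have e2 := cg c hc
    rw [← mul_assoc, e2, mul_assoc, mul_assoc]
    congr 1
    simp only [mul_sub, sub_mul, mul_one, one_mul, e1]

/-! ### Comparison theory -/

lemma re_inner_star_mul (x : Op H) (ξ : H) : (inner ℂ ((star x * x) ξ) ξ).re = ‖x ξ‖ ^ 2 := by
  rw [ContinuousLinearMap.star_eq_adjoint]
  show (inner ℂ (ContinuousLinearMap.adjoint x (x ξ)) ξ).re = _
  rw [ContinuousLinearMap.adjoint_inner_left, inner_self_eq_norm_sq_to_K]
  norm_cast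

lemma mul_ap (S T : Op H) (ξ : H) : (S * T) ξ = S (T ξ) := rfl

lemma inner_star_ap (x : Op H) (ξ η : H) : inner ℂ ((star x) ξ) η = inner ℂ ξ (x η) := by
  rw [ContinuousLinearMap.star_eq_adjoint, ContinuousLinearMap.adjoint_inner_left]

lemma le_of_inner {a b : Op H} (ha : IsSelfAdjoint a) (hb : IsSelfAdjoint b)
    (h : ∀ ξ, (inner ℂ (a ξ) ξ).re ≤ (inner ℂ (b ξ) ξ).re) : a ≤ b := by
  rw [ContinuousLinearMap.le_def, ContinuousLinearMap.isPositive_def']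
  refine ⟨hb.sub ha, fun ξ => ?_⟩
  have := h ξ
  rw [ContinuousLinearMap.reApplyInnerSelf_apply]
  simp [inner_sub_left]
  exact this

lemma star_mul_pos (x : Op H) : 0 ≤ star x * x := star_mul_self_nonneg x

lemma norm_lemma' (N : VonNeumannAlgebra H) {a : Op H} (haN : a ∈ N) (ha : 0 ≤ a) (δ : ℝ)
    (hδ : 0 < δ) :
    ∃ f ∈ N, ∃ s ∈ N, IsProjection f ∧ IsSelfAdjoint s ∧ s * a = a * s ∧ s * a * s = f ∧
      s * f = s ∧ f * s = s ∧
      (∀ ξ, (inner ℂ (a (ξ - f ξ)) (ξ - f ξ)).re ≤ δ * ‖ξ - f ξ‖ ^ 2) ∧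
      (∀ ξ, δ * ‖f ξ‖ ^ 2 ≤ (inner ℂ (a (f ξ)) (f ξ)).re) ∧
      (∀ c : Op H, c * a = a * c → c * f = f * c) ∧
      (∀ c : Op H, c * a = a * c → c * s = s * c) ∧ (δ < ‖a‖ → f ≠ 0) := by
  obtain ⟨f, s, h1, h2, h3, h4, h5, h6, h7, h8, h9, h10⟩ := norm_lemma a ha δ hδ
  refine ⟨f, mem_of_comm N _ fun c hc => h9 c ?_, s, mem_of_comm N _ fun c hc => h10 c ?_,
    h1, h2, h3, h4, h5, h6, h7, h8, h9, h10, ?_⟩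
  · exact (VonNeumannAlgebra.mem_commutant_iff.1 hc a haN).symm
  · exact (VonNeumannAlgebra.mem_commutant_iff.1 hc a haN).symm
  · rintro hlt rfl
    have : a ≤ algebraMap ℝ (Op H) δ := by
      apply le_of_inner (IsSelfAdjoint.of_nonneg ha)
      · exact IsSelfAdjoint.algebraMap (A := Op H) (by simp [IsSelfAdjoint])
      · intro ξ
        rw [inner_algMap]
        simpa using h7 ξ
    have := (CStarAlgebra.norm_le_iff_le_algebraMap a hδ.le ha).2 this
    linarith

lemma exists_pi (N : VonNeumannAlgebra H)
    (hf : relComm (N : Set (Op H)) (N : Set (Op H)) = scalars H) {a b : Op H}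
    (ha : a ∈ N) (hb : b ∈ N) (ha0 : a ≠ 0) (hb0 : b ≠ 0) :
    ∃ w ∈ N, w ≠ 0 ∧ w * (star w * w) = w ∧ (∃ r ∈ N, w = a * r) ∧ (∃ r ∈ N, w = r * b) := by
  obtain ⟨n, hn, hz⟩ := factor_ne N hf ha hb ha0 hb0
  set z := a * n * b with hzd
  have hzN : z ∈ N := mul_mem (mul_mem ha hn) hb
  have hA0 : star z * z ≠ 0 := fun h => hz (CStarRing.star_mul_self_eq_zero_iff z |>.1 h)
  have hAN : star z * z ∈ N := mul_mem (star_mem hzN) hzN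
  obtain ⟨f, hfN, s, hsN, hfp, hs, hsa, hsas, hsf, hfs, -, -, -, -, hne⟩ :=
    norm_lemma' N hAN (star_mul_pos z) (‖star z * z‖ / 2) (by positivity)
  have hf0 := hne (by have := norm_pos_iff.2 hA0; linarith)
  have hww : star (z * s) * (z * s) = f := by
    rw [star_mul, hs.star_eq, ← hsas]; simp only [mul_assoc]
  refine ⟨z * s, mul_mem hzN hsN, ?_, ?_, ⟨n * b * s, ?_, ?_⟩,
    ⟨z * s * s * s * star z * a * n, ?_, ?_⟩⟩
  · intro h; apply hf0; rw [← hww, h]; simp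
  · rw [hww, mul_assoc, hsf]
  · exact mul_mem (mul_mem hn hb) hsN
  · rw [hzd]; simp only [mul_assoc]
  · exact mul_mem (mul_mem (mul_mem (mul_mem (mul_mem (mul_mem hzN hsN) hsN) hsN) (star_mem hzN)) ha) hn
  · have e : s = s * s * s * (star z * z) := by
      conv_lhs => rw [← hsf, ← hsas, mul_assoc s (star z * z) s, ← hsa]
      simp only [mul_assoc]
    calc z * s = z * (s * s * s * (star z * z)) := by rw [← e]
      _ = z * s * s * s * star z * a * n * b := by
        conv_lhs => rw [show star z * z = star z * (a * n * b) from rfl]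
        simp only [mul_assoc]

lemma pi_limit {ι : Type*} [Preorder ι] [IsDirectedOrder ι] [Nonempty ι] (w : ι → Op H)
    (h0 : ∀ i, w i * (star (w i) * w i) = w i)
    (h1 : ∀ i j, i ≤ j → w j * (star (w i) * w i) = w i)
    (h2 : ∀ i j, i ≤ j → star (w j) * w j * (star (w i) * w i) = star (w i) * w i) :
    ∃ u : Op H, (∀ ξ, Tendsto (fun i => w i ξ) atTop (nhds (u ξ))) ∧
      u * (star u * u) = u ∧ (∀ i, u * (star (w i) * w i) = w i) ∧
      (∀ i, star u * u * (star (w i) * w i) = star (w i) * w i) := by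
  have happ : ∀ (S T : Op H) ξ, S = T → S ξ = T ξ := fun S T ξ h => by rw [h]
  have hproj : ∀ i, IsSelfAdjoint (star (w i) * w i) := fun i => IsSelfAdjoint.star_mul_self _
  have hstar : ∀ i, star (w i) * w i * star (w i) = star (w i) := fun i => by
    have := congrArg star (h0 i)
    simpa [mul_assoc] using this
  have hsub : ∀ i j, i ≤ j → ∀ ξ, ‖w j ξ - w i ξ‖ ^ 2 = ‖w j ξ‖ ^ 2 - ‖w i ξ‖ ^ 2 := by
    intro i j hij ξ
    have e2 : star (w j) * w i = star (w i) * w i := by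
      calc star (w j) * w i = star (w j) * (w j * (star (w i) * w i)) := by rw [h1 i j hij]
        _ = _ := by rw [← mul_assoc, h2 i j hij]
    have e3 : star (w i) * w j = star (w i) * w i := by
      have := congrArg star e2
      simpa using this
    have e : star (w j - w i) * (w j - w i) = star (w j) * w j - star (w i) * w i := by
      rw [star_sub, sub_mul, mul_sub, mul_sub, e2, e3]; abel
    have := congrArg (fun T : Op H => (inner ℂ (T ξ) ξ).re) e
    simp only [re_inner_star_mul, sub_apply, inner_sub_left, Complex.sub_re] at this
    rw [this]
  have hnorm : ∀ i ξ, ‖w i ξ‖ ≤ ‖ξ‖ := by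
    intro i ξ
    have e : star (w i) * w i = star (star (w i) * w i) * (star (w i) * w i) := by
      rw [(hproj i).star_eq, mul_assoc, h0 i]
    have e4 : ‖w i ξ‖ ^ 2 = ‖(star (w i) * w i) ξ‖ ^ 2 := by
      rw [← re_inner_star_mul (w i), ← re_inner_star_mul (star (w i) * w i), ← e]
    have h5 : ‖w i ξ‖ ^ 2 ≤ ‖(star (w i) * w i) ξ‖ * ‖ξ‖ := by
      rw [← re_inner_star_mul (w i)]
      exact (Complex.re_le_norm _).trans (norm_inner_le_norm _ _)
    have h6 : ‖w i ξ‖ = ‖(star (w i) * w i) ξ‖ := by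
      rwa [sq_eq_sq₀ (norm_nonneg _) (norm_nonneg _)] at e4
    rw [← h6] at h5
    by_contra hlt
    push Not at hlt
    nlinarith [norm_nonneg ξ]
  have hlim : ∀ ξ, ∃ y, Tendsto (fun i => w i ξ) atTop (nhds y) := by
    intro ξ
    apply cauchy_map_iff_exists_tendsto.1
    rw [Metric.cauchy_iff]
    refine ⟨inferInstance, fun ε hε => ?_⟩
    have hb : BddAbove (Set.range fun i => ‖w i ξ‖ ^ 2) := by
      refine ⟨‖ξ‖ ^ 2, ?_⟩
      rintro _ ⟨i, rfl⟩
      exact pow_le_pow_left₀ (norm_nonneg _) (hnorm i ξ) 2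
    obtain ⟨i, hi⟩ := exists_lt_of_lt_ciSup
      (show (⨆ i, ‖w i ξ‖ ^ 2) - (ε / 2) ^ 2 < ⨆ i, ‖w i ξ‖ ^ 2 by
        have : 0 < (ε / 2) ^ 2 := by positivity
        linarith)
    refine ⟨(fun i => w i ξ) '' Set.Ici i, image_mem_map (Ici_mem_atTop i), ?_⟩
    have hd : ∀ j, i ≤ j → dist (w j ξ) (w i ξ) < ε / 2 := by
      intro j hj
      have h3 := hsub i j hj ξ
      have h4 := le_ciSup hb j
      rw [dist_eq_norm]
      apply lt_of_pow_lt_pow_left₀ 2 (by positivity)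
      have h5 : ‖w j ξ‖ ^ 2 ≤ ⨆ i, ‖w i ξ‖ ^ 2 := h4
      linarith
    rintro _ ⟨j, hj, rfl⟩ _ ⟨k, hk, rfl⟩
    calc dist (w j ξ) (w k ξ) ≤ dist (w j ξ) (w i ξ) + dist (w k ξ) (w i ξ) :=
          dist_triangle_right _ _ _
      _ < ε := by linarith [hd j hj, hd k hk]
  choose F hF using hlim
  obtain ⟨u, hu⟩ : ∃ u : Op H, ∀ ξ, Tendsto (fun i => w i ξ) atTop (nhds (u ξ)) := by
    let u0 : H →ₗ[ℂ] H :=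
      { toFun := F
        map_add' := fun x y => tendsto_nhds_unique (hF (x + y)) (by
          simpa only [map_add] using (hF x).add (hF y))
        map_smul' := fun c x => tendsto_nhds_unique (hF (c • x)) (by
          simpa only [map_smul, RingHom.id_apply] using (hF x).const_smul c) }
    let u : Op H := u0.mkContinuous 1 (fun ξ => by
      rw [one_mul]
      exact le_of_tendsto (hF ξ).norm (Eventually.of_forall fun i => hnorm i ξ))
    exact ⟨u, hF⟩
  have k1 : ∀ i, u * (star (w i) * w i) = w i := by
    intro i
    ext ξ
    refine tendsto_nhds_unique (hu ((star (w i) * w i) ξ)) ?_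
    apply tendsto_const_nhds.congr'
    filter_upwards [eventually_ge_atTop i] with j hj
    exact (happ _ _ ξ (h1 i j hj)).symm
  have k2 : ∀ i, star u * w i = star (w i) * w i := by
    intro i
    ext ξ
    apply ext_inner_right ℂ
    intro η
    have e1 : inner ℂ ((star u * w i) ξ) η = inner ℂ (w i ξ) (u η) := by
      rw [mul_ap, inner_star_ap]
    rw [e1]
    refine tendsto_nhds_unique (tendsto_const_nhds.inner (hu η)) ?_
    apply tendsto_const_nhds.congr'
    filter_upwards [eventually_ge_atTop i] with j hj
    have e2 : star (w j) * w i = star (w i) * w i := by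
      calc star (w j) * w i = star (w j) * (w j * (star (w i) * w i)) := by rw [h1 i j hj]
        _ = _ := by rw [← mul_assoc, h2 i j hj]
    rw [← e2, mul_ap, inner_star_ap]
  have k3 : ∀ i, star u * u * (star (w i) * w i) = star (w i) * w i := by
    intro i
    rw [mul_assoc, k1, k2]
  refine ⟨u, hu, ?_, k1, k3⟩
  have k4 : ∀ i, star (w i) * w i * (star u * u) = star (w i) * w i := by
    intro i
    have := congrArg star (k3 i)
    simpa [mul_assoc] using this
  ext ξ
  refine tendsto_nhds_unique (hu ((star u * u) ξ)) ?_
  have : ∀ i, w i ((star u * u) ξ) = w i ξ := by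
    intro i
    have : w i * (star u * u) = w i := by
      conv_lhs => rw [← h0 i, mul_assoc, k4 i, h0 i]
    exact happ _ _ ξ this
  simp only [this]
  exact hu ξ

lemma pi_limit' {ι : Type*} (r : ι → ι → Prop) (hr : ∀ a, r a a)
    (ht : ∀ a b c, r a b → r b c → r a c) (hd : ∀ a b, ∃ c, r a c ∧ r b c) (hne : Nonempty ι)
    (w : ι → Op H)
    (h0 : ∀ i, w i * (star (w i) * w i) = w i)
    (h1 : ∀ i j, r i j → w j * (star (w i) * w i) = w i)
    (h2 : ∀ i j, r i j → star (w j) * w j * (star (w i) * w i) = star (w i) * w i) :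
    ∃ (u : Op H) (l : Filter ι), l.NeBot ∧ (∀ ξ, Tendsto (fun i => w i ξ) l (nhds (u ξ))) ∧
      u * (star u * u) = u ∧ (∀ i, u * (star (w i) * w i) = w i) ∧
      (∀ i, star u * u * (star (w i) * w i) = star (w i) * w i) := by
  letI : Preorder ι := { le := r, lt := fun a b => r a b ∧ ¬ r b a, le_refl := hr,
                         le_trans := ht, lt_iff_le_not_ge := fun _ _ => Iff.rfl }
  haveI : IsDirectedOrder ι := ⟨hd⟩
  obtain ⟨u, hu⟩ := pi_limit w h0 h1 h2
  exact ⟨u, atTop, inferInstance, hu⟩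

lemma comparability (N : VonNeumannAlgebra H)
    (hfac : relComm (N : Set (Op H)) (N : Set (Op H)) = scalars H) {p f : Op H}
    (hp : p ∈ N) (hf : f ∈ N) (hpp : IsProjection p) (hfp : IsProjection f) :
    ∃ w ∈ N, w * (star w * w) = w ∧ p * w = w ∧ w * f = w ∧
      (star w * w = f ∨ w * star w = p) := by
  let W := {w : Op H // w ∈ N ∧ w * (star w * w) = w ∧ p * w = w ∧ w * f = w}
  let r : W → W → Prop := fun a b => b.1 * (star a.1 * a.1) = a.1 ∧
    star b.1 * b.1 * (star a.1 * a.1) = star a.1 * a.1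
  have hrefl : ∀ a : W, r a a := fun a => ⟨a.2.2.1, by rw [mul_assoc, a.2.2.1]⟩
  have htrans : ∀ {a b c : W}, r a b → r b c → r a c := by
    rintro a b c ⟨h1, h2⟩ ⟨h3, h4⟩
    constructor
    · rw [← h2, ← mul_assoc, h3, h1]
    · rw [← h2, ← mul_assoc, h4]
  obtain ⟨m, hm⟩ := exists_maximal_of_chains_bounded (r := r) (by
    intro C hC
    rcases C.eq_empty_or_nonempty with rfl | hne
    · exact ⟨⟨0, zero_mem N, by simp, by simp, by simp⟩, by simp⟩
    obtain ⟨u, l, hl, hu, hu1, hu2, hu3⟩ := pi_limit' (ι := C) (fun a b => r a.1 b.1)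
      (fun a => hrefl a.1) (fun a b c h1 h2 => htrans h1 h2) (fun a b => by
        by_cases hab : a.1 = b.1
        · have : a = b := Subtype.ext hab
          subst this
          exact ⟨a, hrefl a.1, hrefl a.1⟩
        · rcases hC a.2 b.2 hab with h | h
          · exact ⟨b, h, hrefl b.1⟩
          · exact ⟨a, hrefl a.1, h⟩) hne.to_subtype (fun a => a.1.1) (fun a => a.1.2.2.1)
      (fun a b h => h.1) (fun a b h => h.2)
    have huN : u ∈ N := by
      apply mem_of_comm
      intro c hc
      ext ξ
      refine tendsto_nhds_unique ((c.continuous.tendsto _).comp (hu ξ)) ?_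
      refine (hu (c ξ)).congr fun a => ?_
      exact congrArg (fun T : Op H => T ξ) (VonNeumannAlgebra.mem_commutant_iff.1 hc _ a.1.2.1)
    have hpu : p * u = u := by
      ext ξ
      refine tendsto_nhds_unique ((p.continuous.tendsto _).comp (hu ξ)) ?_
      refine (hu ξ).congr fun a => ?_
      exact (congrArg (fun T : Op H => T ξ) a.1.2.2.2.1).symm
    have huf : u * f = u := by
      ext ξ
      refine tendsto_nhds_unique (hu (f ξ)) ?_
      refine (hu ξ).congr fun a => ?_
      exact (congrArg (fun T : Op H => T ξ) a.1.2.2.2.2).symm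
    exact ⟨⟨u, huN, hu1, hpu, huf⟩, fun a ha => ⟨hu2 ⟨a, ha⟩, hu3 ⟨a, ha⟩⟩⟩) htrans
  obtain ⟨w, hwN, hw, hpw, hwf⟩ := m
  refine ⟨w, hwN, hw, hpw, hwf, ?_⟩
  by_contra hcon
  push Not at hcon
  have hsw : star w * w * star w = star w := by
    have := congrArg star hw
    simpa [mul_assoc] using this
  have hwp : star w * p = star w := by
    have := congrArg star hpw
    simpa [hpp.1.star_eq] using this
  have hfw : f * star w = star w := by
    have := congrArg star hwf
    simpa [hfp.1.star_eq] using this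
  have hsN : star w ∈ N := star_mem hwN
  obtain ⟨z, hzN, hz0, hz, ⟨r1, hr1, hz1⟩, ⟨r2, hr2, hz2⟩⟩ := exists_pi N hfac
    (a := p - w * star w) (b := f - star w * w) (sub_mem hp (mul_mem hwN hsN))
    (sub_mem hf (mul_mem hsN hwN)) (sub_ne_zero.2 hcon.2.symm) (sub_ne_zero.2 hcon.1.symm)
  have a1 : star w * z = 0 := by
    rw [hz1, ← mul_assoc, mul_sub, hwp, ← mul_assoc, hsw]; simp
  have a2 : z * star w = 0 := by
    rw [hz2, mul_assoc, sub_mul, hfw, hsw]; simp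
  have a3 : star z * w = 0 := by
    have := congrArg star a1
    simpa using this
  have a4 : w * star z = 0 := by
    have := congrArg star a2
    simpa using this
  have a5 : p * z = z := by
    rw [hz1, ← mul_assoc, mul_sub, hpp.2.eq, ← mul_assoc, hpw]
  have a6 : z * f = z := by
    rw [hz2, mul_assoc, sub_mul, hfp.2.eq, mul_assoc, hwf]
  have hss : star (w + z) * (w + z) = star w * w + star z * z := by
    rw [star_add, add_mul, mul_add, mul_add, a1, a3]; simp
  have a7 : w * (star z * z) = 0 := by rw [← mul_assoc, a4, zero_mul]
  have a8 : z * (star w * w) = 0 := by rw [← mul_assoc, a2, zero_mul]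
  have := hm ⟨w + z, add_mem hwN hzN, by
    rw [hss, add_mul, mul_add, mul_add, hw, hz, a7, a8]; simp, by rw [mul_add, hpw, a5],
    by rw [add_mul, hwf, a6]⟩ (by
      constructor
      · show (w + z) * (star w * w) = w
        rw [add_mul, hw, a8, add_zero]
      · show star (w + z) * (w + z) * (star w * w) = star w * w
        rw [hss, add_mul, mul_assoc, hw, mul_assoc, a8]; simp)
  have h9 : w * (star (w + z) * (w + z)) = w + z := this.1
  rw [hss, mul_add, hw, a7, add_zero] at h9
  exact hz0 (by simpa using h9)

/-! ### Trace and finite families -/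

lemma tr_star {M : VonNeumannAlgebra H} {τ : Op H →ₗ[ℂ] ℂ}
    (hτ : IsTracialState (M : Set (Op H)) τ) {x : Op H} (hx : x ∈ M) :
    τ (star x) = (starRingEnd ℂ) (τ x) := by
  have key : ∀ y ∈ M, (τ y + τ (star y)).im = 0 := by
    intro y hy
    have h1 := (Complex.nonneg_iff.1 (hτ.pos (y + 1) (add_mem hy (one_mem M)))).2
    have h2 := (Complex.nonneg_iff.1 (hτ.pos y hy)).2
    have e : star (y + 1) * (y + 1) = star y * y + (y + star y) + 1 := by
      rw [star_add, star_one]; noncomm_ring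
    rw [e, map_add, map_add, map_add, hτ.map_one] at h1
    simp only [Complex.add_im, Complex.one_im] at h1 ⊢
    rw [← h2] at h1
    linarith
  have a := key x hx
  have b := key (Complex.I • x) (smul_mem' M _ hx)
  have e : star (Complex.I • x) = (-Complex.I) • star x := by
    rw [star_smul]; simp
  rw [e, map_smul, map_smul] at b
  apply Complex.ext
  · simp at b ⊢; linarith
  · simp at a ⊢; linarith

lemma proj_star_mul {p : Op H} (hp : IsProjection p) : star p * p = p := by
  rw [hp.1.star_eq, hp.2.eq]

lemma proj_nonneg {p : Op H} (hp : IsProjection p) : 0 ≤ p := by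
  rw [← proj_star_mul hp]; exact star_mul_pos p

lemma proj_le_one {p : Op H} (hp : IsProjection p) : p ≤ 1 := by
  have h : IsProjection (1 - p) := ⟨(IsSelfAdjoint.one _).sub hp.1, hp.2.one_sub⟩
  exact sub_nonneg.1 (proj_nonneg h)

lemma tr_proj_pos {M : VonNeumannAlgebra H} {τ : Op H →ₗ[ℂ] ℂ}
    (hτ : IsTracialState (M : Set (Op H)) τ) {p : Op H} (hpM : p ∈ M) (hp : IsProjection p)
    (hp0 : p ≠ 0) : 0 < (τ p).re := by
  have h1 := hτ.pos p hpM
  have h2 := hτ.faithful p hpM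
  rw [proj_star_mul hp] at h1 h2
  obtain ⟨h3, h4⟩ := Complex.nonneg_iff.1 h1
  refine lt_of_le_of_ne h3 fun h => hp0 (h2 ?_)
  exact Complex.ext h.symm h4.symm

lemma fin_family_aux {N : VonNeumannAlgebra H} {τ : Op H →ₗ[ℂ] ℂ}
    (hfac : relComm (N : Set (Op H)) (N : Set (Op H)) = scalars H)
    (hτ : IsTracialState (N : Set (Op H)) τ) {p : Op H} (hpN : p ∈ N) (hp : IsProjection p)
    (k : ℕ) : ∀ r ∈ N, IsProjection r → (τ r).re ≤ k * (τ p).re →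
      ∃ (n : ℕ) (w : Fin n → Op H), (∀ i, w i ∈ N) ∧ (∀ i, p * w i = w i) ∧
        ∑ i, star (w i) * w i = r := by
  induction k with
  | zero =>
    intro r hr hrp hle
    have : r = 0 := by
      by_contra h
      have := tr_proj_pos hτ hr hrp h
      simp at hle
      linarith
    exact ⟨0, fun _ => 0, by simp, by simp, by simp [this]⟩
  | succ k ih =>
    intro r hr hrp hle
    obtain ⟨w, hw, hww, hpw, hwr, h | h⟩ := comparability N hfac hpN hr hp hrp
    · exact ⟨1, fun _ => w, fun _ => hw, fun _ => hpw, by simp [h]⟩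
    · have hrw : r * (star w * w) = star w * w := by
        have := congrArg star hwr
        rw [star_mul, hrp.1.star_eq] at this
        rw [← mul_assoc, this]
      have hwr' : star w * w * r = star w * w := by rw [mul_assoc, hwr]
      have hi : star w * w * (star w * w) = star w * w := by rw [mul_assoc, hww]
      have hsN : star w ∈ N := star_mem hw
      obtain ⟨n, u, h1, h2, h3⟩ := ih (r - star w * w) (sub_mem hr (mul_mem hsN hw))
        ⟨hrp.1.sub (IsSelfAdjoint.star_mul_self w), by
          rw [IsIdempotentElem, sub_mul, mul_sub, mul_sub, hrp.2.eq, hrw, hwr', hi]; abel⟩ (by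
          rw [map_sub, hτ.tracial _ hsN _ hw, h]
          simp only [Complex.sub_re]
          push_cast at hle
          linarith)
      refine ⟨n + 1, Fin.cons w u, ?_, ?_, ?_⟩
      · intro i; refine Fin.cases ?_ ?_ i
        · simpa using hw
        · intro j; simpa using h1 j
      · intro i; refine Fin.cases ?_ ?_ i
        · simpa using hpw
        · intro j; simpa using h2 j
      · rw [Fin.sum_univ_succ]; simp [h3]

lemma fin_family {N : VonNeumannAlgebra H} {τ : Op H →ₗ[ℂ] ℂ}
    (hfac : relComm (N : Set (Op H)) (N : Set (Op H)) = scalars H)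
    (hτ : IsTracialState (N : Set (Op H)) τ) {p : Op H} (hpN : p ∈ N) (hp : IsProjection p)
    (hp0 : p ≠ 0) :
      ∃ (n : ℕ) (w : Fin n → Op H), (∀ i, w i ∈ N) ∧ (∀ i, p * w i = w i) ∧
        ∑ i, star (w i) * w i = 1 := by
  have h := tr_proj_pos hτ hpN hp hp0
  obtain ⟨k, hk⟩ := exists_nat_ge (1 / (τ p).re)
  refine fin_family_aux hfac hτ hpN hp k 1 (one_mem N) ⟨IsSelfAdjoint.one _, IsIdempotentElem.one⟩ ?_
  rw [hτ.map_one]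
  rw [div_le_iff₀ h] at hk
  simpa using hk

lemma corner_center {M : VonNeumannAlgebra H} {τ : Op H →ₗ[ℂ] ℂ}
    (hfac : relComm (M : Set (Op H)) (M : Set (Op H)) = scalars H)
    (hτ : IsTracialState (M : Set (Op H)) τ) {p : Op H} (hpM : p ∈ M) (hp : IsProjection p)
    (hp0 : p ≠ 0) {z : Op H} (hz : z ∈ M) (hpz : p * z * p = z)
    (hc : ∀ x ∈ corner p (M : Set (Op H)), x * z = z * x) : ∃ c : ℂ, z = c • p := by
  obtain ⟨n, w, hw, hpw, hsum⟩ := fin_family hfac hτ hpM hp hp0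
  have hwp : ∀ i, star (w i) * p = star (w i) := fun i => by
    have := congrArg star (hpw i)
    rwa [star_mul, hp.1.star_eq] at this
  have hpz1 : p * z = z := by
    rw [← hpz, ← mul_assoc, ← mul_assoc, hp.2.eq]
  have hpz2 : z * p = z := by
    rw [← hpz, mul_assoc, hp.2.eq]
  have hwM : ∀ i, star (w i) ∈ M := fun i => star_mem (hw i)
  set y := ∑ i, star (w i) * z * w i with hy
  have hyM : y ∈ M := sum_mem fun i _ => mul_mem (mul_mem (hwM i) hz) (hw i)
  have hcomm : ∀ m ∈ M, m * y = y * m := by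
    intro m hm
    calc m * y = (∑ j, star (w j) * w j) * (m * y) := by rw [hsum, one_mul]
      _ = ∑ j, ∑ i, star (w j) * (w j * m * star (w i) * z) * w i := by
        rw [hy, Finset.sum_mul]
        refine Finset.sum_congr rfl fun j _ => ?_
        rw [Finset.mul_sum, Finset.mul_sum]
        refine Finset.sum_congr rfl fun i _ => ?_
        simp only [mul_assoc]
      _ = ∑ j, ∑ i, star (w j) * (z * (w j * m * star (w i))) * w i := by
        refine Finset.sum_congr rfl fun j _ => Finset.sum_congr rfl fun i _ => ?_
        rw [hc]
        refine ⟨mul_mem (mul_mem (hw j) hm) (hwM i), ?_⟩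
        rw [mul_assoc, mul_assoc, hwp, ← mul_assoc, ← mul_assoc, hpw]
      _ = ∑ j, star (w j) * z * w j * m * ∑ i, star (w i) * w i := by
        refine Finset.sum_congr rfl fun j _ => ?_
        rw [Finset.mul_sum]
        refine Finset.sum_congr rfl fun i _ => ?_
        simp only [mul_assoc]
      _ = y * m := by
        rw [hsum, hy, Finset.sum_mul]; simp
  have : y ∈ relComm (M : Set (Op H)) (M : Set (Op H)) := ⟨hyM, hcomm⟩
  rw [hfac] at this
  obtain ⟨c, hcy⟩ := this
  refine ⟨c, ?_⟩
  have e : p * y = z := by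
    calc p * y = ∑ i, (p * star (w i)) * z * w i := by
          rw [hy, Finset.mul_sum]; simp only [mul_assoc]
      _ = ∑ i, z * (p * star (w i)) * w i := by
          refine Finset.sum_congr rfl fun i _ => ?_
          rw [hc]
          refine ⟨mul_mem hpM (hwM i), ?_⟩
          rw [mul_assoc, mul_assoc, hwp, ← mul_assoc, hp.2.eq]
      _ = z * p * ∑ i, star (w i) * w i := by
          rw [Finset.mul_sum]; simp only [mul_assoc]
      _ = z := by rw [hsum, mul_one, hpz2]
  rw [← e, hcy]; simp

/-! ### Conditional expectation -/

section CE
variable {M N : VonNeumannAlgebra H} {τ : Op H →ₗ[ℂ] ℂ} {E : Op H → Op H}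

lemma E_left (hE : IsCondExp τ (M : Set (Op H)) (N : Set (Op H)) E) {n x : Op H} (hn : n ∈ N)
    (hx : x ∈ M) : E (n * x) = n * E x := by
  have := hE.bimod n hn x hx 1 (one_mem N)
  simpa using this

lemma E_right (hE : IsCondExp τ (M : Set (Op H)) (N : Set (Op H)) E) {n x : Op H} (hn : n ∈ N)
    (hx : x ∈ M) : E (x * n) = E x * n := by
  have := hE.bimod 1 (one_mem N) x hx n hn
  simpa using this

lemma E_zero (hE : IsCondExp τ (M : Set (Op H)) (N : Set (Op H)) E) : E 0 = 0 :=
  hE.fix 0 (zero_mem N)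

lemma E_sub (hE : IsCondExp τ (M : Set (Op H)) (N : Set (Op H)) E) {x y : Op H}
    (hx : x ∈ M) (hy : y ∈ M) : E (x - y) = E x - E y := by
  have h1 := hE.map_add x hx ((-1 : ℂ) • y) (smul_mem' M _ hy)
  rw [hE.map_smul _ y hy] at h1
  simpa [sub_eq_add_neg] using h1

lemma E_sum (hE : IsCondExp τ (M : Set (Op H)) (N : Set (Op H)) E) {ι : Type*} (s : Finset ι)
    (x : ι → Op H) (hx : ∀ i, x i ∈ M) : E (∑ i ∈ s, x i) = ∑ i ∈ s, E (x i) := by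
  classical
  induction s using Finset.induction_on with
  | empty => simpa using E_zero hE
  | insert a s ha ih =>
    rw [Finset.sum_insert ha, Finset.sum_insert ha, hE.map_add _ (hx a) _
      (sum_mem fun i _ => hx i), ih]

lemma E_star (hτ : IsTracialState (M : Set (Op H)) τ)
    (hNM : (N : Set (Op H)) ⊆ (M : Set (Op H)))
    (hE : IsCondExp τ (M : Set (Op H)) (N : Set (Op H)) E) {x : Op H} (hx : x ∈ M) :
    E (star x) = star (E x) := by
  have hxs : star x ∈ M := star_mem hx
  have h1 : E (star x) ∈ N := hE.mem _ hxs
  have h2 : E x ∈ N := hE.mem _ hx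
  have h2s : star (E x) ∈ N := star_mem h2
  have hd : E (star x) - star (E x) ∈ N := sub_mem h1 h2s
  have key : ∀ n ∈ N, τ (n * (E (star x) - star (E x))) = 0 := by
    intro n hn
    have hns : star n ∈ N := star_mem hn
    have e1 : τ (n * E (star x)) = τ (n * star x) := by
      rw [← E_left hE hn hxs, hE.tr _ (mul_mem (hNM hn) hxs)]
    have e2 : τ (n * star (E x)) = τ (n * star x) := by
      have a1 : n * star (E x) = star (E x * star n) := by simp
      have a2 : n * star x = star (x * star n) := by simp
      rw [a1, a2, tr_star hτ (hNM (mul_mem h2 hns)), tr_star hτ (mul_mem hx (hNM hns)),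
        ← E_right hE hns hx, hE.tr _ (mul_mem hx (hNM hns))]
    rw [mul_sub, map_sub, e1, e2, sub_self]
  exact sub_eq_zero.1 (hτ.faithful _ (hNM hd) (key _ (star_mem hd)))

lemma E_pos (hτ : IsTracialState (M : Set (Op H)) τ)
    (hNM : (N : Set (Op H)) ⊆ (M : Set (Op H)))
    (hE : IsCondExp τ (M : Set (Op H)) (N : Set (Op H)) E) {x : Op H} (hx : x ∈ M) :
    0 ≤ E (star x * x) := by
  have hxs : star x ∈ M := star_mem hx
  have hxx : star x * x ∈ M := mul_mem hxs hx
  set b := E (star x * x) with hb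
  have hbN : b ∈ N := hE.mem _ hxx
  have hbs : IsSelfAdjoint b := by
    rw [IsSelfAdjoint, hb, ← E_star hτ hNM hE hxx]; simp
  set n := cfc (fun t : ℝ => Real.sqrt (max (-t) 0)) b with hn
  have hnN : n ∈ N := cfc_mem N hbN _
  have hns : IsSelfAdjoint n := cfc_predicate _ b
  set m := cfc (fun t : ℝ => max (-t) 0) b with hm
  have hmN : m ∈ N := cfc_mem N hbN _
  have hms : IsSelfAdjoint m := cfc_predicate _ b
  have e1 : n * b * n = - (m * m) := by
    have : n * b * n = n * cfc (fun t : ℝ => t) b * n := by rw [cfc_id' ℝ b]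
    rw [this, hn, ← cfc_mul _ (fun t : ℝ => t) b (by fun_prop) (by fun_prop),
      ← cfc_mul _ _ b (by fun_prop) (by fun_prop), hm, ← cfc_mul _ _ b (by fun_prop) (by fun_prop),
      ← cfc_neg]
    apply cfc_congr
    intro t _
    have h0 : 0 ≤ max (-t) 0 := le_max_right _ _
    have h1 := Real.mul_self_sqrt h0
    show Real.sqrt (max (-t) 0) * t * Real.sqrt (max (-t) 0) = - (max (-t) 0 * max (-t) 0)
    have h2 : Real.sqrt (max (-t) 0) * t * Real.sqrt (max (-t) 0) = max (-t) 0 * t := by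
      calc _ = (Real.sqrt (max (-t) 0) * Real.sqrt (max (-t) 0)) * t := by ring
        _ = _ := by rw [h1]
    rw [h2]
    rcases le_total (-t) 0 with h | h
    · rw [max_eq_right h]; simp
    · rw [max_eq_left h]; ring
  have e2 : τ (n * b * n) = τ (star (x * n) * (x * n)) := by
    have : star (x * n) * (x * n) = n * (star x * x) * n := by
      rw [star_mul, hns.star_eq]; simp only [mul_assoc]
    rw [this, hb, ← hE.bimod n hnN _ hxx n hnN, hE.tr _ (mul_mem (mul_mem (hNM hnN) hxx) (hNM hnN))]
  have p1 := hτ.pos (x * n) (mul_mem hx (hNM hnN))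
  have p2 := hτ.pos m (hNM hmN)
  rw [← e2, e1, map_neg] at p1
  rw [hms.star_eq] at p2
  have e0 : τ (m * m) = 0 := le_antisymm (neg_nonneg.1 p1) p2
  have m0 : m = 0 := hτ.faithful m (hNM hmN) (by rwa [hms.star_eq])
  have e3 : b + m = cfc (fun t : ℝ => t + max (-t) 0) b := by
    rw [cfc_add b (fun t : ℝ => t) _ (by fun_prop) (by fun_prop), cfc_id' ℝ b]
  rw [m0, add_zero] at e3
  rw [e3]
  apply cfc_nonneg
  intro t _
  rcases le_total (-t) 0 with h | h
  · rw [max_eq_right h]; linarith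
  · rw [max_eq_left h]; linarith

lemma exists_sqrt (M : VonNeumannAlgebra H) {z : Op H} (hz : z ∈ M) (h0 : 0 ≤ z) :
    ∃ x ∈ M, star x * x = z := by
  have hs : IsSelfAdjoint z := IsSelfAdjoint.of_nonneg h0
  refine ⟨cfc (fun t : ℝ => Real.sqrt t) z, cfc_mem M hz _, ?_⟩
  rw [(show IsSelfAdjoint (cfc (fun t : ℝ => Real.sqrt t) z) from cfc_predicate _ z).star_eq,
    ← cfc_mul _ _ z (by fun_prop) (by fun_prop)]
  conv_rhs => rw [← cfc_id' ℝ z]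
  apply cfc_congr
  intro t ht
  exact Real.mul_self_sqrt (spectrum_nonneg_of_nonneg h0 ht)

lemma E_nonneg (hτ : IsTracialState (M : Set (Op H)) τ)
    (hNM : (N : Set (Op H)) ⊆ (M : Set (Op H)))
    (hE : IsCondExp τ (M : Set (Op H)) (N : Set (Op H)) E) {z : Op H} (hz : z ∈ M)
    (h0 : 0 ≤ z) : 0 ≤ E z := by
  obtain ⟨x, hx, rfl⟩ := exists_sqrt M hz h0
  exact E_pos hτ hNM hE hx

lemma E_mono (hτ : IsTracialState (M : Set (Op H)) τ)
    (hNM : (N : Set (Op H)) ⊆ (M : Set (Op H)))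
    (hE : IsCondExp τ (M : Set (Op H)) (N : Set (Op H)) E) {x y : Op H} (hx : x ∈ M) (hy : y ∈ M)
    (h : x ≤ y) : E x ≤ E y := by
  have := E_nonneg hτ hNM hE (sub_mem hy hx) (sub_nonneg.2 h)
  rw [E_sub hE hy hx] at this
  exact sub_nonneg.1 this

lemma E_faithful (hτ : IsTracialState (M : Set (Op H)) τ)
    (hE : IsCondExp τ (M : Set (Op H)) (N : Set (Op H)) E) {x : Op H} (hx : x ∈ M)
    (h : E (star x * x) = 0) : x = 0 := by
  apply hτ.faithful x hx
  rw [← hE.tr _ (mul_mem (star_mem (s := M) hx) hx), h, map_zero]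

lemma E_kadison (hτ : IsTracialState (M : Set (Op H)) τ)
    (hNM : (N : Set (Op H)) ⊆ (M : Set (Op H)))
    (hE : IsCondExp τ (M : Set (Op H)) (N : Set (Op H)) E) {x : Op H} (hx : x ∈ M) :
    star (E x) * E x ≤ E (star x * x) := by
  have hxs : star x ∈ M := star_mem hx
  have hxx : star x * x ∈ M := mul_mem hxs hx
  have h2 : E x ∈ N := hE.mem _ hx
  have h2s : star (E x) ∈ N := star_mem h2
  have := E_pos hτ hNM hE (sub_mem hx (hNM h2))
  have e : star (x - E x) * (x - E x) =
      star x * x - star x * E x - (star (E x) * x - star (E x) * E x) := by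
    rw [star_sub]; noncomm_ring
  rw [e, E_sub hE (sub_mem hxx (mul_mem hxs (hNM h2))) (sub_mem (mul_mem (hNM h2s) hx)
    (mul_mem (hNM h2s) (hNM h2))), E_sub hE hxx (mul_mem hxs (hNM h2)),
    E_sub hE (mul_mem (hNM h2s) hx) (mul_mem (hNM h2s) (hNM h2)), E_right hE h2 hxs,
    E_left hE h2s hx, hE.fix _ (mul_mem h2s h2), E_star hτ hNM hE hx] at this
  rw [sub_self, sub_zero] at this
  exact sub_nonneg.1 this

lemma E_bdd (hτ : IsTracialState (M : Set (Op H)) τ)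
    (hNM : (N : Set (Op H)) ⊆ (M : Set (Op H)))
    (hE : IsCondExp τ (M : Set (Op H)) (N : Set (Op H)) E) {b x : Op H} (hb : b ∈ M)
    (hx : x ∈ M) (ξ : H) :
    ‖E (b * x) ξ‖ ^ 2 ≤ ‖b‖ ^ 2 * (inner ℂ (E (star x * x) ξ) ξ).re := by
  have hbx := mul_mem hb hx
  have hxx : star x * x ∈ M := mul_mem (star_mem (s := M) hx) hx
  rw [← re_inner_star_mul]
  have h1 := inner_mono (E_kadison hτ hNM hE hbx) ξ
  have h2 : star (b * x) * (b * x) ≤ ((‖b‖ ^ 2 : ℝ) : ℂ) • (star x * x) := by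
    apply le_of_inner (IsSelfAdjoint.star_mul_self _)
    · rw [IsSelfAdjoint, star_smul]; simp
    · intro η
      rw [re_inner_star_mul, smul_apply, inner_smul_left, Complex.conj_ofReal,
        Complex.re_ofReal_mul, re_inner_star_mul, mul_ap, ← mul_pow]
      exact pow_le_pow_left₀ (norm_nonneg _) (b.le_opNorm _) 2
  have h3 := inner_mono (E_mono hτ hNM hE (mul_mem (star_mem (s := M) hbx) hbx)
    (smul_mem' M _ hxx) h2) ξ
  rw [hE.map_smul _ _ hxx, smul_apply, inner_smul_left, Complex.conj_ofReal,
        Complex.re_ofReal_mul] at h3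
  linarith

end CE

/-! ### Forward direction -/

lemma rsmul_inner (c : ℝ) (A : Op H) (ξ : H) :
    (inner ℂ ((c • A) ξ) ξ).re = c * (inner ℂ (A ξ) ξ).re := by
  have : (c • A) ξ = (c : ℂ) • A ξ := by simp
  rw [this, inner_smul_left, Complex.conj_ofReal, Complex.re_ofReal_mul]

set_option maxHeartbeats 800000 in
lemma fwd_core {M N : VonNeumannAlgebra H} {τ : Op H →ₗ[ℂ] ℂ} {E : Op H → Op H}
    (hfac : relComm (M : Set (Op H)) (M : Set (Op H)) = scalars H)
    (hτ : IsTracialState (M : Set (Op H)) τ)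
    (hNM : (N : Set (Op H)) ⊆ (M : Set (Op H)))
    (hirr : relComm (N : Set (Op H)) (M : Set (Op H)) = scalars H)
    (hE : IsCondExp τ (M : Set (Op H)) (N : Set (Op H)) E)
    {p V f : Op H} (hpM : p ∈ M) (hp : IsProjection p) (hp0 : p ≠ 0) (hV : V ∈ M) (hV0 : V ≠ 0)
    (hVp : V * p = V) (hf : f ∈ N) (hfp : IsProjection f) (hfV : f * V = V)
    (hEV : E (V * star V) = f)
    (A : Op H → Op H) (hA : ∀ y ∈ M, A y ∈ N) (hAV : ∀ y ∈ M, A y * V = V * y * p)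
    (hVA : ∀ y ∈ M, star V * A y = p * y * star V) :
    HasFiniteIndex (M : Set (Op H)) E := by
  obtain ⟨n, w, hw, hpw, hsum⟩ := fin_family hfac hτ hpM hp hp0
  have hwM : ∀ i, star (w i) ∈ M := fun i => star_mem (hw i)
  have hVs : star V ∈ M := star_mem hV
  have hpV : p * star V = star V := by
    have := congrArg star hVp
    rwa [star_mul, hp.1.star_eq] at this
  have hVf : star V * f = star V := by
    have := congrArg star hfV
    rwa [star_mul, hfp.1.star_eq] at this
  have hVwM : ∀ i, V * w i ∈ M := fun i => mul_mem hV (hw i)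
  have F1 : ∀ y ∈ M, E (V * y * star V) = A y * f := by
    intro y hy
    rw [← hEV, ← E_left hE (hA y hy) (mul_mem hV hVs), ← mul_assoc, hAV y hy, mul_assoc _ p, hpV]
  set T : Op H → Op H := fun x => ∑ i, star (w i) * star V * E (V * w i * x) with hT
  have hTE : ∀ x ∈ M, ∀ i, E (V * w i * x) ∈ N := fun x hx i => hE.mem _ (mul_mem (hVwM i) hx)
  have hTM : ∀ x ∈ M, T x ∈ M := fun x hx =>
    sum_mem fun i _ => mul_mem (mul_mem (hwM i) hVs) (hNM (hTE x hx i))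
  have T1 : ∀ y ∈ M, ∀ m ∈ N, T (y * star V * m) = y * star V * m := by
    intro y hy m hm
    have e : ∀ i, star (w i) * star V * E (V * w i * (y * star V * m)) =
        star (w i) * w i * (y * star V * m) := by
      intro i
      have e1 : V * w i * (y * star V * m) = (V * (w i * y) * star V) * m := by
        simp only [mul_assoc]
      have hwy := mul_mem (hw i) hy
      rw [e1, E_right hE hm (mul_mem (mul_mem hV hwy) hVs), F1 _ hwy]
      calc star (w i) * star V * (A (w i * y) * f * m)
          = star (w i) * (star V * A (w i * y)) * f * m := by simp only [mul_assoc]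
        _ = star (w i) * (p * w i) * y * (star V * f) * m := by
            rw [hVA _ hwy]; simp only [mul_assoc]
        _ = _ := by rw [hpw, hVf]; simp only [mul_assoc]
    show ∑ i, _ = _
    rw [Finset.sum_congr rfl fun i _ => e i, ← Finset.sum_mul, hsum, one_mul]
  have T2 : ∀ y ∈ M, ∀ x ∈ M, E (V * y * T x) = E (V * y * x) := by
    intro y hy x hx
    have hyw : ∀ j, y * star (w j) ∈ M := fun j => mul_mem hy (hwM j)
    have e : ∀ j, E (V * y * (star (w j) * star V * E (V * w j * x))) =
        E (V * y * (star (w j) * w j) * x) := by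
      intro j
      have e1 : V * y * (star (w j) * star V * E (V * w j * x)) =
          V * (y * star (w j)) * star V * E (V * w j * x) := by simp only [mul_assoc]
      have hVwx := mul_mem (hVwM j) hx
      have e2 : f * (V * w j * x) = V * w j * x := by
        rw [← mul_assoc, ← mul_assoc, hfV]
      rw [e1, E_right hE (hTE x hx j) (mul_mem (mul_mem hV (hyw j)) hVs), F1 _ (hyw j), mul_assoc,
        ← E_left hE hf hVwx, e2, ← E_left hE (hA _ (hyw j)) hVwx]
      congr 1
      calc A (y * star (w j)) * (V * w j * x) = A (y * star (w j)) * V * w j * x := by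
            simp only [mul_assoc]
        _ = V * y * star (w j) * (p * w j) * x := by
            rw [hAV _ (hyw j)]; simp only [mul_assoc]
        _ = _ := by rw [hpw]; simp only [mul_assoc]
    have hm : ∀ j, V * y * (star (w j) * star V * E (V * w j * x)) ∈ M := fun j =>
      mul_mem (mul_mem hV hy) (mul_mem (mul_mem (hwM j) hVs) (hNM (hTE x hx j)))
    rw [show V * y * T x = ∑ j, V * y * (star (w j) * star V * E (V * w j * x)) from
      Finset.mul_sum _ _ _, E_sum hE _ _ hm, Finset.sum_congr rfl fun j _ => e j,
      ← E_sum hE _ _ (fun j => mul_mem (mul_mem (mul_mem hV hy) (mul_mem (hwM j) (hw j))) hx),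
      ← Finset.sum_mul, ← Finset.mul_sum, hsum, mul_one]
  have Tsum : ∀ (x : Fin n → Op H), (∀ j, x j ∈ M) → T (∑ j, x j) = ∑ j, T (x j) := by
    intro x hx
    show ∑ i, _ = ∑ j, ∑ i, _
    rw [Finset.sum_comm]
    refine Finset.sum_congr rfl fun i _ => ?_
    rw [Finset.mul_sum, E_sum hE _ _ (fun j => mul_mem (hVwM i) (hx j)), Finset.mul_sum]
  have T3 : ∀ y ∈ M, ∀ x ∈ M, T (y * T x) = y * T x := by
    intro y hy x hx
    have e : y * T x = ∑ j, (y * star (w j)) * star V * E (V * w j * x) := by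
      rw [show T x = ∑ i, star (w i) * star V * E (V * w i * x) from rfl, Finset.mul_sum]
      simp only [mul_assoc]
    rw [e, Tsum _ (fun j => mul_mem (mul_mem (mul_mem hy (hwM j)) hVs) (hNM (hTE x hx j)))]
    exact Finset.sum_congr rfl fun j _ => T1 _ (mul_mem hy (hwM j)) _ (hTE x hx j)
  have T4 : ∀ y ∈ M, ∀ x ∈ M, T (y * T x) = T (y * x) := by
    intro y hy x hx
    show ∑ i, _ = ∑ i, _
    refine Finset.sum_congr rfl fun i _ => ?_
    have := T2 (w i * y) (mul_mem (hw i) hy) x hx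
    rw [show V * w i * (y * T x) = V * (w i * y) * T x by simp only [mul_assoc], this]
    simp only [mul_assoc]
  have T5 : ∀ y ∈ M, T y = y * T 1 := by
    intro y hy
    rw [← T3 y hy 1 (one_mem M), T4 y hy 1 (one_mem M), mul_one]
  have hr : T 1 ∈ relComm (N : Set (Op H)) (M : Set (Op H)) := by
    refine ⟨hTM 1 (one_mem M), fun m hm => ?_⟩
    rw [← T5 m (hNM hm)]
    show ∑ i, _ = (∑ i, _) * m
    rw [Finset.sum_mul]
    refine Finset.sum_congr rfl fun i _ => ?_
    rw [E_right hE hm (hVwM i), mul_one, mul_assoc _ _ m]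
  rw [hirr] at hr
  obtain ⟨c, hc⟩ := hr
  have hVs0 : star V ≠ 0 := by simpa using hV0
  have hc1 : c = 1 := by
    have h1 := T1 1 (one_mem M) 1 (one_mem N)
    rw [one_mul, mul_one, T5 _ hVs, hc] at h1
    have : (c - 1) • star V = 0 := by
      rw [sub_smul, one_smul, sub_eq_zero]; simpa using h1
    rcases smul_eq_zero.1 this with h | h
    · exact sub_eq_zero.1 h
    · exact absurd h hVs0
  have T6 : ∀ y ∈ M, ∑ i, star (w i) * star V * E (V * w i * y) = y := by
    intro y hy
    have := T5 y hy
    rw [hc, hc1] at this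
    simpa using this
  clear_value T
  obtain ⟨K, hK⟩ : ∃ K : ℝ, K = ∑ i, ‖star (w i) * star V‖ * ‖V * w i‖ := ⟨_, rfl⟩
  have hK0 : 0 ≤ K := by
    rw [hK]
    exact Finset.sum_nonneg fun i _ => mul_nonneg (norm_nonneg _) (norm_nonneg _)
  refine ⟨K ^ 2 + 1, add_pos_of_nonneg_of_pos (sq_nonneg K) one_pos, ?_⟩
  intro z hz hzp
  have hz0 : 0 ≤ z := (ContinuousLinearMap.nonneg_iff_isPositive z).2 hzp
  have hEz := E_nonneg hτ hNM hE hz hz0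
  rw [← ContinuousLinearMap.le_def]
  apply le_of_inner (IsSelfAdjoint.of_nonneg hz0)
  · rw [IsSelfAdjoint, star_smul, (IsSelfAdjoint.of_nonneg hEz).star_eq]; simp
  intro ξ
  rw [rsmul_inner]
  have hQ : 0 ≤ (inner ℂ (E z ξ) ξ).re := by simpa using inner_mono hEz ξ
  obtain ⟨x, hx, rfl⟩ := exists_sqrt M hz hz0
  rw [re_inner_star_mul]
  set Q := (inner ℂ (E (star x * x) ξ) ξ).re with hQd
  have h1 : ‖x ξ‖ ≤ K * Real.sqrt Q := by
    conv_lhs => rw [← T6 x hx]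
    rw [sum_apply, hK, Finset.sum_mul]
    refine norm_sum_le_of_le _ fun i _ => ?_
    rw [mul_ap, mul_assoc (‖star (w i) * star V‖)]
    refine (ContinuousLinearMap.le_opNorm _ _).trans ?_
    refine mul_le_mul_of_nonneg_left ?_ (norm_nonneg (star (w i) * star V))
    have h2 := E_bdd hτ hNM hE (hVwM i) hx ξ
    refine le_of_sq_le_sq (b := ‖V * w i‖ * Real.sqrt Q) ?_ (mul_nonneg (norm_nonneg _) (Real.sqrt_nonneg _))
    rwa [mul_pow, Real.sq_sqrt hQ]
  have h3 : ‖x ξ‖ ^ 2 ≤ K ^ 2 * Q := by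
    rw [← Real.sq_sqrt hQ, ← mul_pow]
    exact pow_le_pow_left₀ (norm_nonneg _) h1 2
  linarith

lemma fwd {M N : VonNeumannAlgebra H} {τ : Op H →ₗ[ℂ] ℂ} {E : Op H → Op H}
    (hfac : relComm (M : Set (Op H)) (M : Set (Op H)) = scalars H)
    (hτ : IsTracialState (M : Set (Op H)) τ)
    (hNM : (N : Set (Op H)) ⊆ (M : Set (Op H)))
    (hirr : relComm (N : Set (Op H)) (M : Set (Op H)) = scalars H)
    (hE : IsCondExp τ (M : Set (Op H)) (N : Set (Op H)) E)
    (h : CornerEmbeds (M : Set (Op H)) (N : Set (Op H)) (M : Set (Op H))) :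
    HasFiniteIndex (M : Set (Op H)) E := by
  obtain ⟨p, q, v, θ, hpM, hp, hp0, hqN, hq, hq0, ⟨hθm, -, -, -, hθs⟩, hv, hv0, -, hqvp, hint⟩ := h
  have hvp : v * p = v := by
    conv_lhs => rw [← hqvp, mul_assoc, hp.2.eq, hqvp]
  have hvs : star v ∈ M := star_mem (s := M) hv
  have hpv : p * star v = star v := by
    have := congrArg star hvp
    rwa [star_mul, hp.1.star_eq] at this
  have hvv : v * star v ∈ M := mul_mem hv hvs
  have hcor : ∀ y ∈ M, p * y * p ∈ corner p (M : Set (Op H)) := by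
    intro y hy
    refine ⟨mul_mem (mul_mem hpM hy) hpM, ?_⟩
    have e : p * (p * y * p) * p = (p * p) * y * (p * p) := by simp only [mul_assoc]
    rw [e, hp.2.eq]
  have hint' : ∀ x ∈ corner p (M : Set (Op H)), x * star v = star v * θ x := by
    intro x hx
    have hxs : star x ∈ corner p (M : Set (Op H)) := by
      refine ⟨star_mem (s := M) hx.1, ?_⟩
      have := congrArg star hx.2
      simpa [hp.1.star_eq, mul_assoc] using this
    have := congrArg star (hint _ hxs)
    rw [hθs x hx] at this
    simpa using this.symm
  set a := E (v * star v) with ha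
  have haN : a ∈ N := hE.mem _ hvv
  have ha0 : 0 ≤ a := by
    have := E_pos hτ hNM hE hvs
    rwa [star_star] at this
  have hane : a ≠ 0 := by
    intro h
    have := E_faithful hτ hE hvs (by rwa [star_star])
    exact hv0 (by simpa using this)
  have hθN : ∀ x ∈ corner p (M : Set (Op H)), θ x ∈ N := fun x hx => (hθm x hx).1
  have hcomm : ∀ x ∈ corner p (M : Set (Op H)), θ x * a = a * θ x := by
    intro x hx
    rw [ha, ← E_left hE (hθN x hx) hvv, ← E_right hE (hθN x hx) hvv, ← mul_assoc, hint x hx,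
      mul_assoc, hint' x hx, mul_assoc]
  obtain ⟨f, hfN, s, hsN, hfp, hs, hsa, hsas, hsf, hfs, -, -, -, hcs, hne⟩ :=
    norm_lemma' N haN ha0 (‖a‖ / 2) (by positivity)
  have hf0 := hne (by have := norm_pos_iff.2 hane; linarith)
  have hEV : E (s * v * star (s * v)) = f := by
    rw [← hsas, ha, ← hE.bimod s hsN _ hvv s hsN, star_mul, hs.star_eq]
    simp only [mul_assoc]
  refine fwd_core hfac hτ hNM hirr hE hpM hp hp0 (V := s * v) (f := f) (mul_mem (hNM hsN) hv) ?_ ?_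
    hfN hfp ?_ hEV (fun y => θ (p * y * p)) ?_ ?_ ?_
  · intro h
    rw [h, zero_mul, E_zero hE] at hEV
    exact hf0 hEV.symm
  · rw [mul_assoc, hvp]
  · rw [← mul_assoc, hfs]
  · intro y hy; exact hθN _ (hcor y hy)
  · intro y hy
    show θ (p * y * p) * (s * v) = _
    rw [← mul_assoc, hcs _ (hcomm _ (hcor y hy)), mul_assoc, hint _ (hcor y hy)]
    rw [← mul_assoc v, ← mul_assoc v, hvp]
    simp only [mul_assoc]
  · intro y hy
    show star (s * v) * θ (p * y * p) = _
    rw [star_mul, hs.star_eq, mul_assoc, ← hcs _ (hcomm _ (hcor y hy)), ← mul_assoc,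
      ← hint' _ (hcor y hy), mul_assoc _ p, hpv]
    simp only [mul_assoc]

/-! ### Copies -/

lemma tr_zero {M : VonNeumannAlgebra H} {τ : Op H →ₗ[ℂ] ℂ}
    (hτ : IsTracialState (M : Set (Op H)) τ) {z : Op H} (hz : z ∈ M) (h0 : 0 ≤ z)
    (h : τ z = 0) : z = 0 := by
  obtain ⟨x, hx, rfl⟩ := exists_sqrt M hz h0
  rw [hτ.faithful x hx h]; simp

lemma exists_nonscalar {N : VonNeumannAlgebra H} {τ : Op H →ₗ[ℂ] ℂ} (hN : IsII1Factor N τ)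
    {f : Op H} (hfN : f ∈ N) (hf : IsProjection f) (hf0 : f ≠ 0) :
    ∃ a ∈ N, IsSelfAdjoint a ∧ f * a = a ∧ a * f = a ∧ ∀ c : ℂ, a ≠ c • f := by
  by_contra hcon
  push Not at hcon
  have hall : ∀ a ∈ N, f * a = a → a * f = a → ∃ c : ℂ, a = c • f := by
    intro a ha h1 h2
    have has : star a ∈ N := star_mem ha
    have h1s : star a * f = star a := by
      have := congrArg star h1
      rwa [star_mul, hf.1.star_eq] at this
    have h2s : f * star a = star a := by
      have := congrArg star h2
      rwa [star_mul, hf.1.star_eq] at this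
    obtain ⟨c, hc⟩ := hcon (a + star a) (add_mem ha has) (IsSelfAdjoint.add_star_self a)
      (by rw [mul_add, h1, h2s]) (by rw [add_mul, h2, h1s])
    obtain ⟨d, hd⟩ := hcon (Complex.I • (a - star a)) (smul_mem' N _ (sub_mem ha has))
      (by rw [IsSelfAdjoint, star_smul, star_sub, star_star]; simp [smul_sub]; abel)
      (by rw [mul_smul_comm, mul_sub, h1, h2s]) (by rw [smul_mul_assoc, sub_mul, h2, h1s])
    refine ⟨(1 / 2) * (c - Complex.I * d), ?_⟩
    have e : a = (1 / 2 : ℂ) • ((a + star a) - Complex.I • (Complex.I • (a - star a))) := by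
      rw [smul_smul, Complex.I_mul_I]
      module
    rw [hc, hd] at e
    rw [e]; module
  obtain ⟨n, w, hw, hpw, hsum⟩ := fin_family hN.factor hN.trace hfN hf hf0
  have hws : ∀ i, star (w i) ∈ N := fun i => star_mem (hw i)
  have hwp : ∀ i, star (w i) * f = star (w i) := fun i => by
    have := congrArg star (hpw i)
    rwa [star_mul, hf.1.star_eq] at this
  apply hN.infdim
  classical
  refine ⟨Finset.image (fun ij : Fin n × Fin n => star (w ij.1) * w ij.2) Finset.univ, ?_⟩
  intro x hx
  have e : x = ∑ i, ∑ j, star (w i) * (w i * x * star (w j)) * w j := by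
    calc x = (∑ i, star (w i) * w i) * x * (∑ j, star (w j) * w j) := by
          rw [hsum, one_mul, mul_one]
      _ = _ := by
        rw [Finset.sum_mul, Finset.sum_mul]
        refine Finset.sum_congr rfl fun i _ => ?_
        rw [Finset.mul_sum]
        refine Finset.sum_congr rfl fun j _ => ?_
        simp only [mul_assoc]
  rw [e]
  refine sum_mem fun i _ => sum_mem fun j _ => ?_
  obtain ⟨c, hc⟩ := hall (w i * x * star (w j)) (mul_mem (mul_mem (hw i) hx) (hws j))
    (by rw [← mul_assoc, ← mul_assoc, hpw]) (by rw [mul_assoc, hwp])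
  rw [hc, mul_smul_comm, hwp, smul_mul_assoc]
  apply Submodule.smul_mem
  apply Submodule.subset_span
  simp only [Finset.coe_image, Finset.coe_univ, Set.image_univ, Set.mem_range]
  exact ⟨(i, j), rfl⟩

lemma halving {N : VonNeumannAlgebra H} {τ : Op H →ₗ[ℂ] ℂ} (hN : IsII1Factor N τ)
    {f : Op H} (hfN : f ∈ N) (hf : IsProjection f) (hf0 : f ≠ 0) :
    ∃ w ∈ N, w ≠ 0 ∧ w * (star w * w) = w ∧ f * w = w ∧ w * f = w ∧ w * w = 0 := by
  obtain ⟨a, haN, has, hfa, haf, hne⟩ := exists_nonscalar hN hfN hf hf0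
  have hτ := hN.trace
  have hfpos := tr_proj_pos hτ hfN hf hf0
  obtain ⟨t, ht⟩ : ∃ t : ℝ, t = (τ a).re / (τ f).re := ⟨_, rfl⟩
  have im0 : ∀ x ∈ N, IsSelfAdjoint x → (τ x).im = 0 := by
    intro x hx hxs
    have := tr_star hτ hx
    rw [hxs.star_eq] at this
    exact Complex.conj_eq_iff_im.1 this.symm
  obtain ⟨b, hb⟩ : ∃ b : Op H, b = a - (t : ℂ) • f := ⟨_, rfl⟩
  have hbN : b ∈ N := by rw [hb]; exact sub_mem haN (smul_mem' N _ hfN)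
  have hbs : IsSelfAdjoint b := by
    rw [hb, IsSelfAdjoint, star_sub, star_smul, has.star_eq, hf.1.star_eq]; simp
  have hb0 : b ≠ 0 := by
    rw [hb]; exact sub_ne_zero.2 (hne _)
  have hfb : f * b = b := by rw [hb, mul_sub, hfa, mul_smul_comm, hf.2.eq]
  have hbf : b * f = b := by rw [hb, sub_mul, haf, smul_mul_assoc, hf.2.eq]
  have hτb : τ b = 0 := by
    apply Complex.ext
    · rw [hb, map_sub, map_smul, smul_eq_mul, Complex.sub_re, Complex.re_ofReal_mul, ht]
      field_simp
      simp
    · exact im0 b hbN hbs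
  obtain ⟨P, hP⟩ : ∃ P, P = cfc (fun t : ℝ => max t 0) b := ⟨_, rfl⟩
  obtain ⟨Q, hQ⟩ : ∃ P, P = cfc (fun t : ℝ => max (-t) 0) b := ⟨_, rfl⟩
  have hPN : P ∈ N := by rw [hP]; exact cfc_mem N hbN _
  have hQN : Q ∈ N := by rw [hQ]; exact cfc_mem N hbN _
  have hPs : IsSelfAdjoint P := by rw [hP]; exact cfc_predicate _ b
  have hQs : IsSelfAdjoint Q := by rw [hQ]; exact cfc_predicate _ b
  have hP0 : 0 ≤ P := by rw [hP]; exact cfc_nonneg fun t _ => le_max_right _ _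
  have hQ0 : 0 ≤ Q := by rw [hQ]; exact cfc_nonneg fun t _ => le_max_right _ _
  have hbPQ : b = P - Q := by
    conv_lhs => rw [← cfc_id' ℝ b]
    rw [hP, hQ, ← cfc_sub _ _ b (by fun_prop) (by fun_prop)]
    apply cfc_congr
    intro t _
    show t = max t 0 - max (-t) 0
    rcases le_total t 0 with h | h
    · rw [max_eq_right h, max_eq_left (by linarith)]; ring
    · rw [max_eq_left h, max_eq_right (by linarith)]; ring
  have hQP : Q * P = 0 := by
    rw [hP, hQ, ← cfc_mul _ _ b (by fun_prop) (by fun_prop), ← cfc_zero ℝ b]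
    apply cfc_congr
    intro t _
    show max (-t) 0 * max t 0 = 0
    rcases le_total t 0 with h | h
    · rw [max_eq_right h]; ring
    · rw [max_eq_right (a := -t) (by linarith)]; ring
  have hPne : P ≠ 0 := by
    intro h
    rw [h, zero_sub] at hbPQ
    rw [hbPQ, map_neg, neg_eq_zero] at hτb
    apply hb0
    rw [hbPQ, tr_zero hτ hQN hQ0 hτb, neg_zero]
  have hQne : Q ≠ 0 := by
    intro h
    rw [h, sub_zero] at hbPQ
    rw [hbPQ] at hτb
    apply hb0
    rw [hbPQ, tr_zero hτ hPN hP0 hτb]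
  have hbP : b * P = P * P := by rw [hbPQ, sub_mul, hQP, sub_zero]
  have hQb : Q * b = -(Q * Q) := by rw [hbPQ, mul_sub, hQP, zero_sub]
  have hPP : P * P ≠ 0 := by
    intro h
    apply hPne
    have := (CStarRing.star_mul_self_eq_zero_iff P).1 (by rw [hPs.star_eq, h])
    exact this
  have hQQ : Q * Q ≠ 0 := by
    intro h
    apply hQne
    have := (CStarRing.star_mul_self_eq_zero_iff Q).1 (by rw [hQs.star_eq, h])
    exact this
  obtain ⟨w, hwN, hw0, hw, ⟨r, hr, h1⟩, ⟨r', hr', h2⟩⟩ := exists_pi N hN.factor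
    (mul_mem hPN hPN) (mul_mem hQN hQN) hPP hQQ
  have hQQf : Q * Q * f = Q * Q := by
    have : Q * Q = - (Q * b) := by rw [hQb, neg_neg]
    rw [this, neg_mul, mul_assoc, hbf]
  refine ⟨w, hwN, hw0, hw, ?_, ?_, ?_⟩
  · rw [h1, ← hbP, ← mul_assoc, ← mul_assoc, hfb]
  · rw [h2, mul_assoc, hQQf]
  · have : w * w = r' * (Q * (Q * P) * P) * r := by
      nth_rewrite 1 [h2]
      nth_rewrite 1 [h1]
      simp only [mul_assoc]
    rw [this, hQP]; simp

lemma copies {N : VonNeumannAlgebra H} {τ : Op H →ₗ[ℂ] ℂ} (hN : IsII1Factor N τ) (k : ℕ) :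
    ∀ f ∈ N, IsProjection f → f ≠ 0 →
    ∃ (ι : Type) (_ : Fintype ι) (u : ι → Op H) (q : Op H), Fintype.card ι = 2 ^ k ∧ q ∈ N ∧
      q ≠ 0 ∧ IsProjection q ∧ f * q = q ∧ (∀ i, u i ∈ N) ∧ (∀ i, u i * star (u i) = q) ∧
      (∀ i, u i * f = u i) ∧ (∀ i j, i ≠ j → u i * star (u j) = 0) := by
  induction k with
  | zero =>
    intro f hf hfp hf0
    refine ⟨Unit, inferInstance, fun _ => f, f, by simp, hf, hf0, hfp, hfp.2.eq, fun _ => hf,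
      fun _ => ?_, fun _ => hfp.2.eq, ?_⟩
    · rw [hfp.1.star_eq, hfp.2.eq]
    · intro i j h; exact absurd (Subsingleton.elim i j) h
  | succ k ih =>
    intro f hf hfp hf0
    obtain ⟨w, hwN, hw0, hw, hfw, hwf, hww⟩ := halving hN hf hfp hf0
    have hws : star w ∈ N := star_mem hwN
    have hfws : f * star w = star w := by
      have := congrArg star hwf
      rwa [star_mul, hfp.1.star_eq] at this
    have hwsf : star w * f = star w := by
      have := congrArg star hfw
      rwa [star_mul, hfp.1.star_eq] at this
    obtain ⟨ι, hι, u, q, hcard, hq, hq0, hqp, hfq, huN, huu, huf, huo⟩ :=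
      ih (star w * w) (mul_mem hws hwN)
        ⟨IsSelfAdjoint.star_mul_self w, by rw [IsIdempotentElem, mul_assoc, hw]⟩
        (fun h => hw0 ((CStarRing.star_mul_self_eq_zero_iff w).1 h))
    have huw : ∀ i, u i * w = 0 := by
      intro i
      rw [← huf i]
      simp only [mul_assoc, hww, mul_zero]
    have hwu : ∀ i, star w * star (u i) = 0 := by
      intro i
      have := congrArg star (huw i)
      simpa using this
    have hwwu : ∀ i, star w * (w * star (u i)) = star (u i) := by
      intro i
      have := congrArg star (huf i)
      simpa [mul_assoc] using this
    refine ⟨ι ⊕ ι, inferInstance, Sum.elim u (fun i => u i * star w), q, ?_, hq, hq0, hqp,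
      ?_, ?_, ?_, ?_, ?_⟩
    · simp [hcard]; ring
    · rw [← hfq, ← mul_assoc, ← mul_assoc, hfws]
    · rintro (i | i)
      · exact huN i
      · exact mul_mem (huN i) hws
    · rintro (i | i)
      · exact huu i
      · simp only [Sum.elim_inr, star_mul, star_star, mul_assoc, hwwu, huu]
    · rintro (i | i)
      · show u i * f = u i
        rw [← huf i, mul_assoc, mul_assoc, hwf]
      · show u i * star w * f = _
        rw [mul_assoc, hwsf]; rfl
    · rintro (i | i) (j | j) hij
      · exact huo i j fun h => hij (by rw [h])
      · simp only [Sum.elim_inl, Sum.elim_inr, star_mul, star_star]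
        rw [← mul_assoc, huw, zero_mul]
      · simp only [Sum.elim_inl, Sum.elim_inr]
        rw [mul_assoc, hwu, mul_zero]
      · simp only [Sum.elim_inr, star_mul, star_star, mul_assoc, hwwu]
        exact huo i j fun h => hij (by rw [h])

/-! ### Backward direction -/

section Back
variable {M N : VonNeumannAlgebra H} {τ : Op H →ₗ[ℂ] ℂ} {E : Op H → Op H}

lemma norm_le_form {x : Op H} {c : ℝ} (hc : 0 ≤ c) (h : ∀ ξ, ‖x ξ‖ ^ 2 ≤ c * ‖ξ‖ ^ 2) :
    ‖x‖ ^ 2 ≤ c := by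
  have : ‖x‖ ≤ Real.sqrt c := by
    refine x.opNorm_le_bound (Real.sqrt_nonneg c) fun ξ => ?_
    refine le_of_sq_le_sq ?_ (mul_nonneg (Real.sqrt_nonneg c) (norm_nonneg ξ))
    rw [mul_pow, Real.sq_sqrt hc]
    exact h ξ
  calc ‖x‖ ^ 2 ≤ Real.sqrt c ^ 2 := pow_le_pow_left₀ (norm_nonneg _) this 2
    _ = c := Real.sq_sqrt hc

lemma form_le_norm {x : Op H} {c : ℝ} (h : ‖x‖ ^ 2 ≤ c) (ξ : H) : ‖x ξ‖ ^ 2 ≤ c * ‖ξ‖ ^ 2 := by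
  calc ‖x ξ‖ ^ 2 ≤ (‖x‖ * ‖ξ‖) ^ 2 := pow_le_pow_left₀ (norm_nonneg _) (x.le_opNorm ξ) 2
    _ = ‖x‖ ^ 2 * ‖ξ‖ ^ 2 := mul_pow _ _ _
    _ ≤ _ := mul_le_mul_of_nonneg_right h (sq_nonneg _)

lemma proj_form {p : Op H} (hp : IsProjection p) (ξ : H) :
    (inner ℂ (p ξ) ξ).re = ‖p ξ‖ ^ 2 := by
  rw [← re_inner_star_mul, proj_star_mul hp]

lemma proj_norm_le {p : Op H} (hp : IsProjection p) (ξ : H) : ‖p ξ‖ ^ 2 ≤ ‖ξ‖ ^ 2 := by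
  have := inner_mono (proj_le_one hp) ξ
  rw [proj_form hp] at this
  have h2 := re_inner_star_mul (1 : Op H) ξ
  rw [star_one, one_mul] at h2
  rw [h2] at this
  exact this

lemma E_form (hτ : IsTracialState (M : Set (Op H)) τ)
    (hNM : (N : Set (Op H)) ⊆ (M : Set (Op H)))
    (hE : IsCondExp τ (M : Set (Op H)) (N : Set (Op H)) E) {x : Op H} (hx : x ∈ M) {c : ℝ}
    (h : ∀ ξ, ‖x ξ‖ ^ 2 ≤ c * ‖ξ‖ ^ 2) (ξ : H) :
    (inner ℂ (E (star x * x) ξ) ξ).re ≤ c * ‖ξ‖ ^ 2 := by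
  have hc1 : c • (1 : Op H) ∈ N := rsmul_mem' N c (one_mem N)
  have e : ∀ η : H, (inner ℂ ((c • (1 : Op H)) η) η).re = c * ‖η‖ ^ 2 := by
    intro η
    rw [rsmul_inner]
    have h2 := re_inner_star_mul (1 : Op H) η
    rw [star_one, one_mul] at h2
    rw [h2]; rfl
  have h1 : star x * x ≤ c • (1 : Op H) := by
    apply le_of_inner (IsSelfAdjoint.star_mul_self x)
    · rw [IsSelfAdjoint, star_smul, star_one]; simp
    · intro η
      rw [re_inner_star_mul, e]
      exact h η
  have := inner_mono (E_mono hτ hNM hE (mul_mem (star_mem (s := M) hx) hx) (hNM hc1) h1) ξ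
  rwa [hE.fix _ hc1, e] at this

lemma E_comp (hτ : IsTracialState (M : Set (Op H)) τ)
    (hNM : (N : Set (Op H)) ⊆ (M : Set (Op H)))
    (hE : IsCondExp τ (M : Set (Op H)) (N : Set (Op H)) E) {x y : Op H} (hx : x ∈ M) (hy : y ∈ M)
    (h : ∀ ξ, ‖x ξ‖ ^ 2 ≤ ‖y ξ‖ ^ 2) (ξ : H) :
    (inner ℂ (E (star x * x) ξ) ξ).re ≤ (inner ℂ (E (star y * y) ξ) ξ).re := by
  have h1 : star x * x ≤ star y * y := by
    apply le_of_inner (IsSelfAdjoint.star_mul_self x) (IsSelfAdjoint.star_mul_self y)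
    intro η
    rw [re_inner_star_mul, re_inner_star_mul]
    exact h η
  exact inner_mono (E_mono hτ hNM hE (mul_mem (star_mem (s := M) hx) hx)
    (mul_mem (star_mem (s := M) hy) hy) h1) ξ

lemma exists_sup (hτ : IsTracialState (M : Set (Op H)) τ)
    (hE : IsCondExp τ (M : Set (Op H)) (N : Set (Op H)) E)
    (hfin : HasFiniteIndex (M : Set (Op H)) E) :
    ∃ Λ : ℝ, 1 ≤ Λ ∧ (∀ x ∈ M, ∀ δ : ℝ, 0 < δ →
        (∀ ξ, (inner ℂ (E (star x * x) ξ) ξ).re ≤ δ * ‖ξ‖ ^ 2) → ‖x‖ ^ 2 ≤ Λ * δ) ∧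
      ∀ ε : ℝ, 0 < ε → ∃ x ∈ M, (∀ ξ, (inner ℂ (E (star x * x) ξ) ξ).re ≤ ‖ξ‖ ^ 2) ∧
        Λ - ε < ‖x‖ ^ 2 := by
  obtain ⟨c, hc, hb⟩ := hfin
  set S : Set ℝ := {r | ∃ x ∈ M, (∀ ξ, (inner ℂ (E (star x * x) ξ) ξ).re ≤ ‖ξ‖ ^ 2) ∧
    r = ‖x‖ ^ 2} with hS
  have hone : (1 : Op H) ≠ 0 := by
    intro h
    have := hτ.map_one
    rw [h, map_zero] at this
    exact zero_ne_one this
  have hnt : Nontrivial H := by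
    by_contra hn
    rw [not_nontrivial_iff_subsingleton] at hn
    exact hone (by ext ξ; exact Subsingleton.elim _ _)
  have h1S : (1 : ℝ) ∈ S := by
    refine ⟨1, one_mem M, fun ξ => ?_, ?_⟩
    · rw [star_one, one_mul, hE.fix 1 (one_mem N)]
      have h2 := re_inner_star_mul (1 : Op H) ξ
      rw [star_one, one_mul] at h2
      rw [h2]; exact le_rfl
    · rw [norm_one]; norm_num
  have hSb : BddAbove S := by
    refine ⟨c, ?_⟩
    rintro _ ⟨x, hx, h, rfl⟩
    apply norm_le_form hc.le
    intro ξ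
    have h1 := hb (star x * x) (mul_mem (star_mem (s := M) hx) hx)
      ((ContinuousLinearMap.nonneg_iff_isPositive _).1 (star_mul_pos x))
    rw [← ContinuousLinearMap.le_def] at h1
    have h2 := inner_mono h1 ξ
    rw [re_inner_star_mul, rsmul_inner] at h2
    exact h2.trans (mul_le_mul_of_nonneg_left (h ξ) hc.le)
  refine ⟨sSup S, le_csSup hSb h1S, ?_, ?_⟩
  · intro x hx δ hδ h
    obtain ⟨t, ht, htt⟩ : ∃ t : ℝ, 0 < t ∧ t ^ 2 = δ :=
      ⟨Real.sqrt δ, Real.sqrt_pos.2 hδ, Real.sq_sqrt hδ.le⟩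
    have hmem : ‖t⁻¹ • x‖ ^ 2 ∈ S := by
      refine ⟨t⁻¹ • x, rsmul_mem' M _ hx, fun ξ => ?_, rfl⟩
      have e : star (t⁻¹ • x) * (t⁻¹ • x) = ((δ⁻¹ : ℝ) : ℂ) • (star x * x) := by
        rw [star_smul, smul_mul_smul_comm, ← htt]
        have : star t⁻¹ * t⁻¹ = (t ^ 2)⁻¹ := by
          rw [star_trivial]; field_simp
        rw [this]; simp only [Complex.coe_smul]
      rw [e, hE.map_smul _ _ (mul_mem (star_mem (s := M) hx) hx)]
      have := rsmul_inner δ⁻¹ (E (star x * x)) ξ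
      rw [Complex.coe_smul, this]
      calc δ⁻¹ * (inner ℂ (E (star x * x) ξ) ξ).re ≤ δ⁻¹ * (δ * ‖ξ‖ ^ 2) :=
            mul_le_mul_of_nonneg_left (h ξ) (inv_nonneg.2 hδ.le)
        _ = ‖ξ‖ ^ 2 := by field_simp
    have := le_csSup hSb hmem
    rw [norm_smul, mul_pow, Real.norm_eq_abs, sq_abs, inv_pow, htt, inv_mul_le_iff₀ hδ] at this
    linarith
  · intro ε hε
    obtain ⟨r, ⟨x, hx, h, rfl⟩, hr⟩ := exists_lt_of_lt_csSup ⟨1, h1S⟩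
      (show sSup S - ε < sSup S by linarith)
    exact ⟨x, hx, h, hr⟩

lemma exists_hx (hτ : IsTracialState (M : Set (Op H)) τ)
    (hNM : (N : Set (Op H)) ⊆ (M : Set (Op H)))
    (hE : IsCondExp τ (M : Set (Op H)) (N : Set (Op H)) E) {Λ : ℝ} (hΛ1 : 1 ≤ Λ)
    (hΛ : ∀ x ∈ M, ∀ δ : ℝ, 0 < δ →
        (∀ ξ, (inner ℂ (E (star x * x) ξ) ξ).re ≤ δ * ‖ξ‖ ^ 2) → ‖x‖ ^ 2 ≤ Λ * δ)
    (hopt : ∀ ε : ℝ, 0 < ε → ∃ x ∈ M, (∀ ξ, (inner ℂ (E (star x * x) ξ) ξ).re ≤ ‖ξ‖ ^ 2) ∧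
        Λ - ε < ‖x‖ ^ 2) :
    ∃ h ∈ M, ∃ x ∈ M, ∃ f ∈ N, IsProjection h ∧ h ≠ 0 ∧ IsProjection f ∧ h * x = x ∧ x * f = x ∧
      E (star x * x) = f ∧ ∀ ξ, h ξ = ξ → (Λ - 1 / 4) * ‖ξ‖ ^ 2 ≤ ‖(star x) ξ‖ ^ 2 := by
  obtain ⟨y, hy, hy1, hyn⟩ := hopt (1 / 8) (by norm_num)
  have hys : star y ∈ M := star_mem (s := M) hy
  have hd0 : 0 ≤ y * star y := mul_star_self_nonneg y
  obtain ⟨h, hhM, -, -, hh, -, -, -, -, -, -, hlow, -, -, hne⟩ :=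
    norm_lemma' M (mul_mem hy hys) hd0 (Λ - 1 / 8) (by linarith)
  have hh0 : h ≠ 0 := hne (by rw [CStarRing.norm_self_mul_star]; nlinarith)
  have hx2 : h * y ∈ M := mul_mem hhM hy
  have hx2s : star (h * y) * (h * y) ∈ M := mul_mem (star_mem (s := M) hx2) hx2
  obtain ⟨a, ha⟩ : ∃ a, a = E (star (h * y) * (h * y)) := ⟨_, rfl⟩
  have haN : a ∈ N := by rw [ha]; exact hE.mem _ hx2s
  have ha0 : 0 ≤ a := by rw [ha]; exact E_pos hτ hNM hE hx2
  have ha1 : ∀ ξ, (inner ℂ (a ξ) ξ).re ≤ ‖ξ‖ ^ 2 := by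
    intro ξ
    rw [ha]
    refine (E_comp hτ hNM hE hx2 hy (fun η => ?_) ξ).trans (hy1 ξ)
    rw [mul_ap]; exact proj_norm_le hh _
  have hΛ0 : 0 < Λ := by linarith
  obtain ⟨f, hfN, s, hsN, hf, hs, -, hsas, hsf, hfs, hup, -, -, -, -⟩ :=
    norm_lemma' N haN ha0 (1 / (8 * Λ)) (by positivity)
  refine ⟨h, hhM, h * y * s, mul_mem hx2 (hNM hsN), f, hfN, hh, hh0, hf, ?_, ?_, ?_, ?_⟩
  · rw [← mul_assoc, ← mul_assoc, hh.2.eq]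
  · rw [mul_assoc, hsf]
  · rw [← hsas, ha, ← hE.bimod s hsN _ hx2s s hsN, star_mul _ s, hs.star_eq]
    simp only [mul_assoc]
  · intro ξ hξ
    have e1 : ‖(star (h * y)) ξ‖ ^ 2 = ‖(star y) ξ‖ ^ 2 := by
      rw [star_mul, mul_ap, hh.1.star_eq, hξ]
    have l1 : (Λ - 1 / 8) * ‖ξ‖ ^ 2 ≤ ‖(star (h * y)) ξ‖ ^ 2 := by
      have := hlow ξ
      rw [hξ] at this
      have e := re_inner_star_mul (star y) ξ
      rw [star_star] at e
      rw [e] at this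
      rwa [e1]
    obtain ⟨η, hη⟩ : ∃ η, η = (star (h * y)) ξ := ⟨_, rfl⟩
    rw [← hη] at l1
    have l2 : ‖f η‖ ^ 2 ≤ ‖s η‖ ^ 2 := by
      have := ha1 (s η)
      rw [← proj_form hf, ← hsas]
      rw [mul_ap, mul_ap]
      nth_rewrite 1 [← hs.star_eq]
      rwa [inner_star_ap]
    have l3 : ‖η - f η‖ ^ 2 ≤ 1 / 8 * ‖ξ‖ ^ 2 := by
      have hfM := hNM hfN
      have h1f : IsProjection (1 - f) := ⟨(IsSelfAdjoint.one _).sub hf.1, hf.2.one_sub⟩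
      have hmN : (1 - f) ∈ N := sub_mem (one_mem N) hfN
      have hm : h * y * (1 - f) ∈ M := mul_mem hx2 (hNM hmN)
      have hn := hΛ _ hm (1 / (8 * Λ)) (by positivity) (fun ζ => by
        have e : E (star (h * y * (1 - f)) * (h * y * (1 - f))) = (1 - f) * a * (1 - f) := by
          rw [ha, ← hE.bimod _ hmN _ hx2s _ hmN, star_mul _ (1 - f), h1f.1.star_eq]
          simp only [mul_assoc]
        have e2 : (1 - f) ζ = ζ - f ζ := by simp
        rw [e, mul_ap, mul_ap]
        nth_rewrite 1 [← h1f.1.star_eq]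
        rw [inner_star_ap, e2]
        refine (hup ζ).trans ?_
        refine mul_le_mul_of_nonneg_left ?_ (by positivity)
        rw [← e2]
        exact proj_norm_le h1f ζ)
      rw [← norm_star] at hn
      have h3 := form_le_norm hn ξ
      have e3 : (star (h * y * (1 - f))) ξ = η - f η := by
        rw [star_mul _ (1 - f), h1f.1.star_eq, mul_ap, ← hη]; simp
      rw [e3] at h3
      have e4 : Λ * (1 / (8 * Λ)) = 1 / 8 := by field_simp
      rwa [e4] at h3
    have l4 : ‖η‖ ^ 2 = ‖f η‖ ^ 2 + ‖η - f η‖ ^ 2 := by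
      have h1f : IsProjection (1 - f) := ⟨(IsSelfAdjoint.one _).sub hf.1, hf.2.one_sub⟩
      have e2 : (1 - f) η = η - f η := by simp
      rw [← e2, ← proj_form hf, ← proj_form h1f, ← Complex.add_re, ← inner_add_left, e2]
      have h2 := re_inner_star_mul (1 : Op H) η
      rw [star_one, one_mul] at h2
      rw [add_sub_cancel]
      exact h2.symm
    have e5 : (star (h * y * s)) ξ = s η := by
      rw [star_mul _ s, hs.star_eq, mul_ap, ← hη]
    rw [e5]
    nlinarith

end Back

section Back2
variable {M N : VonNeumannAlgebra H} {τ : Op H →ₗ[ℂ] ℂ} {E : Op H → Op H}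

lemma proj_mul_pi {u q : Op H} (hq : IsProjection q) (h : u * star u = q) : q * u = u := by
  have : (q * u - u) * star (q * u - u) = 0 := by
    rw [star_sub, star_mul, hq.1.star_eq, sub_mul, mul_sub, mul_sub, ← mul_assoc, mul_assoc q u,
      h, hq.2.eq, hq.2.eq, ← mul_assoc, h, hq.2.eq]
    simp
  exact sub_eq_zero.1 ((CStarRing.mul_star_self_eq_zero_iff _).1 this)

lemma bessel {ι : Type} [Fintype ι] {n : ι → Op H} {q : Op H} (hq : IsProjection q)
    (hn : ∀ i, n i * star (n i) = q) (ho : ∀ i j, i ≠ j → n i * star (n j) = 0) (η : H) :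
    ∑ i, ‖n i η‖ ^ 2 ≤ ‖η‖ ^ 2 := by
  classical
  have hG : IsProjection (∑ i, star (n i) * n i) := by
    constructor
    · rw [IsSelfAdjoint, star_sum]
      refine Finset.sum_congr rfl fun i _ => ?_
      simp
    · rw [IsIdempotentElem, Finset.sum_mul]
      refine Finset.sum_congr rfl fun i _ => ?_
      rw [Finset.mul_sum, Finset.sum_eq_single i]
      · calc star (n i) * n i * (star (n i) * n i) = star (n i) * (n i * star (n i) * n i) := by
              simp only [mul_assoc]
          _ = _ := by rw [hn, proj_mul_pi hq (hn i)]
      · intro j _ hj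
        calc star (n i) * n i * (star (n j) * n j) = star (n i) * (n i * star (n j)) * n j := by
              simp only [mul_assoc]
          _ = 0 := by rw [ho i j hj.symm]; simp
      · simp
  have h1 := proj_norm_le hG η
  rw [← proj_form hG] at h1
  rw [sum_apply, sum_inner, Complex.re_sum] at h1
  simpa only [re_inner_star_mul] using h1

lemma claim_core (hτ : IsTracialState (M : Set (Op H)) τ)
    (hNM : (N : Set (Op H)) ⊆ (M : Set (Op H)))
    (hE : IsCondExp τ (M : Set (Op H)) (N : Set (Op H)) E) {Λ : ℝ} (hΛ1 : 1 ≤ Λ)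
    (hΛ : ∀ x ∈ M, ∀ δ : ℝ, 0 < δ →
        (∀ ξ, (inner ℂ (E (star x * x) ξ) ξ).re ≤ δ * ‖ξ‖ ^ 2) → ‖x‖ ^ 2 ≤ Λ * δ)
    {h x f y q r : Op H} (hx : x ∈ M) (hf : f ∈ N) (hy : y ∈ M) (hq : q ∈ N) (hr : r ∈ N)
    (hh : IsProjection h) (hfp : IsProjection f) (hrp : IsProjection r)
    (hxf : x * f = x) (hxx : E (star x * x) = f)
    (hlow : ∀ ξ, h ξ = ξ → (Λ - 1 / 4) * ‖ξ‖ ^ 2 ≤ ‖(star x) ξ‖ ^ 2)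
    (hhy : h * y = y) (hyy : E (star y * y) = q) (hxy : E (star x * y) = 0) (hqr : q * r = r)
    {ι : Type} [Fintype ι] {n : ι → Op H} (hcard : 4 * Λ ≤ Fintype.card ι)
    (hnN : ∀ i, n i ∈ N) (hn : ∀ i, n i * star (n i) = r)
    (ho : ∀ i j, i ≠ j → n i * star (n j) = 0) (hnf : ∀ i, n i * f = n i) : r = 0 := by
  have hxs : star x ∈ M := star_mem (s := M) hx
  have hys : star y ∈ M := star_mem (s := M) hy
  have hfx : f * star x = star x := by
    have := congrArg star hxf
    rwa [star_mul, hfp.1.star_eq] at this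
  have hyx : E (star y * x) = 0 := by
    have := E_star hτ hNM hE (mul_mem hxs hy)
    rw [star_mul, star_star, hxy, star_zero] at this
    exact this
  have hrn : ∀ i, r * n i = n i := fun i => proj_mul_pi hrp (hn i)
  have hqn : ∀ i, q * n i = n i := fun i => by rw [← hrn i, ← mul_assoc, hqr]
  have hnr : ∀ i, star (n i) * r = star (n i) := fun i => by
    have := congrArg star (hrn i)
    rwa [star_mul, hrp.1.star_eq] at this
  have hfn : ∀ i, f * star (n i) = star (n i) := fun i => by
    have := congrArg star (hnf i)
    rwa [star_mul, hfp.1.star_eq] at this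
  have hnS : ∀ i, star (n i) ∈ N := fun i => star_mem (hnN i)
  have hX : ∀ i ξ, ‖(star (x * (f - star (n i) * n i) + y * n i)) ξ‖ ^ 2 ≤ Λ * ‖ξ‖ ^ 2 := by
    intro i ξ
    obtain ⟨g, hg⟩ : ∃ g, g = f - star (n i) * n i := ⟨_, rfl⟩
    have hgN : g ∈ N := by rw [hg]; exact sub_mem hf (mul_mem (hnS i) (hnN i))
    have hgs : star g = g := by rw [hg, star_sub, hfp.1.star_eq]; simp
    have hgf : g * f * g = g := by
      have e1 : star (n i) * n i * (star (n i) * n i) = star (n i) * n i := by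
        calc _ = star (n i) * (n i * star (n i) * n i) := by simp only [mul_assoc]
          _ = _ := by rw [hn, hrn]
      have e2 : f * (star (n i) * n i) = star (n i) * n i := by rw [← mul_assoc, hfn]
      have e3 : star (n i) * n i * f = star (n i) * n i := by rw [mul_assoc, hnf]
      rw [hg]
      simp only [sub_mul, mul_sub, hfp.2.eq, e1, e2, e3]
      abel
    rw [← hg]
    have m1 : x * g ∈ M := mul_mem hx (hNM hgN)
    have m2 : y * n i ∈ M := mul_mem hy (hNM (hnN i))
    have e : E (star (x * g + y * n i) * (x * g + y * n i)) = f := by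
      have e0 : star (x * g + y * n i) * (x * g + y * n i) =
          (g * (star x * x) * g + g * (star x * y) * n i) +
          (star (n i) * (star y * x) * g + star (n i) * (star y * y) * n i) := by
        rw [star_add, star_mul, star_mul, hgs]
        noncomm_ring
      have k1 : g * (star x * x) * g ∈ M := mul_mem (mul_mem (hNM hgN) (mul_mem hxs hx)) (hNM hgN)
      have k2 : g * (star x * y) * n i ∈ M :=
        mul_mem (mul_mem (hNM hgN) (mul_mem hxs hy)) (hNM (hnN i))
      have k3 : star (n i) * (star y * x) * g ∈ M :=
        mul_mem (mul_mem (hNM (hnS i)) (mul_mem hys hx)) (hNM hgN)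
      have k4 : star (n i) * (star y * y) * n i ∈ M :=
        mul_mem (mul_mem (hNM (hnS i)) (mul_mem hys hy)) (hNM (hnN i))
      rw [e0, hE.map_add _ (add_mem k1 k2) _ (add_mem k3 k4), hE.map_add _ k1 _ k2,
        hE.map_add _ k3 _ k4, hE.bimod g hgN _ (mul_mem hxs hx) g hgN,
        hE.bimod g hgN _ (mul_mem hxs hy) _ (hnN i), hE.bimod _ (hnS i) _ (mul_mem hys hx) g hgN,
        hE.bimod _ (hnS i) _ (mul_mem hys hy) _ (hnN i), hxx, hxy, hyx, hyy, hgf, mul_assoc _ q,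
        hqn]
      simp only [mul_zero, zero_mul, add_zero, zero_add]
      rw [hg]; abel
    have h1 := hΛ _ (add_mem m1 m2) 1 one_pos (fun ζ => by
      rw [e, proj_form hfp, one_mul]; exact proj_norm_le hfp ζ)
    rw [mul_one, ← norm_star] at h1
    exact form_le_norm h1 ξ
  have hX2 : ∀ i ξ, ‖(star (x * (f - star (n i) * n i) + y * n i)) ξ‖ ^ 2 =
      ‖(star x) ξ‖ ^ 2 - ‖n i ((star x) ξ)‖ ^ 2 + ‖(r * star y) ξ‖ ^ 2 := by
    intro i ξ
    obtain ⟨X, hXd⟩ : ∃ X, X = x * (f - star (n i) * n i) + y * n i := ⟨_, rfl⟩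
    have hXe : X = x - x * star (n i) * n i + y * n i := by
      rw [hXd, mul_sub, hxf, mul_assoc]
    have hXs : star X = star x - star (n i) * (n i * star x) + star (n i) * star y := by
      rw [hXe]; simp [mul_assoc]
    have hnns : n i * star (n i) * n i = n i := by rw [hn, hrn]
    have c1 : ∀ T, n i * (star (n i) * (n i * T)) = n i * T := fun T => by
      rw [← mul_assoc, ← mul_assoc, hnns]
    have c3 : star (n i) * (n i * star (n i)) = star (n i) := by rw [hn, hnr]
    have c2 : ∀ T, star (n i) * (n i * (star (n i) * T)) = star (n i) * T := fun T => by
      rw [← mul_assoc (n i), ← mul_assoc, c3]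
    have e : X * star X = star (star x) * star x - star (n i * star x) * (n i * star x)
        + star (r * star y) * (r * star y) := by
      rw [hXs, hXe]
      have hr1 : star (r * star y) * (r * star y) = y * (n i * (star (n i) * star y)) := by
        rw [star_mul, star_star, hrp.1.star_eq]
        calc y * r * (r * star y) = y * (r * r) * star y := by simp only [mul_assoc]
          _ = y * (n i * star (n i)) * star y := by rw [hrp.2.eq, hn]
          _ = _ := by simp only [mul_assoc]
      rw [hr1]
      simp only [star_mul, star_star, add_mul, sub_mul, mul_add, mul_sub, mul_assoc, c1, c2]
      abel
    have h2 := congrArg (fun T : Op H => (inner ℂ (T ξ) ξ).re) e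
    have h3 : X * star X = star (star X) * star X := by rw [star_star]
    rw [h3] at h2
    simp only [re_inner_star_mul, sub_apply, add_apply, inner_sub_left, inner_add_left,
      Complex.sub_re, Complex.add_re] at h2
    rw [← hXd, h2, mul_ap (n i)]
  have hxn : ∀ ξ, ‖(star x) ξ‖ ^ 2 ≤ Λ * ‖ξ‖ ^ 2 := by
    intro ξ
    have h1 := hΛ x hx 1 one_pos (fun ζ => by
      rw [hxx, proj_form hfp, one_mul]; exact proj_norm_le hfp ζ)
    rw [mul_one, ← norm_star] at h1
    exact form_le_norm h1 ξ
  have hk0 : (0 : ℝ) < Fintype.card ι := by linarith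
  have hmain : ∀ ξ, h ξ = ξ → ‖(r * star y) ξ‖ ^ 2 ≤ 1 / 2 * ‖ξ‖ ^ 2 := by
    intro ξ hξ
    have h1 : ∀ i, ‖(r * star y) ξ‖ ^ 2 ≤ 1 / 4 * ‖ξ‖ ^ 2 + ‖n i ((star x) ξ)‖ ^ 2 := by
      intro i
      have a1 := hX i ξ
      rw [hX2] at a1
      have a2 := hlow ξ hξ
      linarith
    have h2 := Finset.sum_le_sum (fun (i : ι) (_ : i ∈ Finset.univ) => h1 i)
    rw [Finset.sum_add_distrib, Finset.sum_const, Finset.sum_const, Finset.card_univ,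
      nsmul_eq_mul, nsmul_eq_mul] at h2
    have h3 := bessel hrp hn ho ((star x) ξ)
    have h4 := hxn ξ
    have h5 : (Fintype.card ι : ℝ) * ‖(r * star y) ξ‖ ^ 2 ≤
        (Fintype.card ι : ℝ) * (1 / 2 * ‖ξ‖ ^ 2) := by
      nlinarith [sq_nonneg ‖ξ‖]
    exact le_of_mul_le_mul_left h5 hk0
  have hyh : star y * h = star y := by
    have := congrArg star hhy
    rwa [star_mul, hh.1.star_eq] at this
  have hmain2 : ∀ ξ, ‖(r * star y) ξ‖ ^ 2 ≤ 1 / 2 * ‖ξ‖ ^ 2 := by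
    intro ξ
    have h1 := hmain (h ξ) (by rw [← mul_ap, hh.2.eq])
    rw [← mul_ap, mul_assoc, hyh] at h1
    have := proj_norm_le hh ξ
    linarith
  have h1 := norm_le_form (by norm_num) hmain2
  rw [← norm_star, star_mul, star_star, hrp.1.star_eq] at h1
  have h2 := E_form hτ hNM hE (mul_mem hy (hNM hr)) (form_le_norm h1)
  have e : E (star (y * r) * (y * r)) = r := by
    have : star (y * r) * (y * r) = r * (star y * y) * r := by
      rw [star_mul, hrp.1.star_eq]; simp only [mul_assoc]
    rw [this, hE.bimod r hr _ (mul_mem hys hy) r hr, hyy, mul_assoc, hqr, hrp.2.eq]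
  rw [e] at h2
  ext ξ
  have h3 := h2 (r ξ)
  rw [proj_form hrp, ← mul_ap, hrp.2.eq] at h3
  have h4 : ‖r ξ‖ ^ 2 = 0 := le_antisymm (by linarith) (sq_nonneg _)
  simpa using h4

lemma claim (hN : IsII1Factor N τ) (hτ : IsTracialState (M : Set (Op H)) τ)
    (hNM : (N : Set (Op H)) ⊆ (M : Set (Op H)))
    (hE : IsCondExp τ (M : Set (Op H)) (N : Set (Op H)) E) {Λ : ℝ} (hΛ1 : 1 ≤ Λ)
    (hΛ : ∀ x ∈ M, ∀ δ : ℝ, 0 < δ →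
        (∀ ξ, (inner ℂ (E (star x * x) ξ) ξ).re ≤ δ * ‖ξ‖ ^ 2) → ‖x‖ ^ 2 ≤ Λ * δ)
    {h x f y : Op H} (hx : x ∈ M) (hf : f ∈ N) (hy : y ∈ M)
    (hh : IsProjection h) (hfp : IsProjection f) (hf0 : f ≠ 0)
    (hxf : x * f = x) (hxx : E (star x * x) = f)
    (hlow : ∀ ξ, h ξ = ξ → (Λ - 1 / 4) * ‖ξ‖ ^ 2 ≤ ‖(star x) ξ‖ ^ 2)
    (hhy : h * y = y) (hxy : E (star x * y) = 0) : y = 0 := by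
  by_contra hy0
  have hxs : star x ∈ M := star_mem (s := M) hx
  have hyy : star y * y ∈ M := mul_mem (star_mem (s := M) hy) hy
  obtain ⟨b, hb⟩ : ∃ b, b = E (star y * y) := ⟨_, rfl⟩
  have hbN : b ∈ N := by rw [hb]; exact hE.mem _ hyy
  have hb0 : 0 ≤ b := by rw [hb]; exact E_pos hτ hNM hE hy
  have hbne : b ≠ 0 := fun h0 => hy0 (E_faithful hτ hE hy (by rw [← hb, h0]))
  obtain ⟨q, hqN, s, hsN, hq, hs, -, hsas, -, -, -, -, -, -, hne⟩ :=
    norm_lemma' N hbN hb0 (‖b‖ / 2) (by positivity)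
  have hq0 := hne (by have := norm_pos_iff.2 hbne; linarith)
  obtain ⟨z, hzN, hz0, hz, ⟨r1, hr1, hz1⟩, ⟨r2, hr2, hz2⟩⟩ :=
    exists_pi N hN.factor hqN hf hq0 hf0
  have hqz : q * z = z := by rw [hz1, ← mul_assoc, hq.2.eq]
  have hzf : z * f = z := by rw [hz2, mul_assoc, hfp.2.eq]
  have hzs : star z ∈ N := star_mem hzN
  obtain ⟨m, hm⟩ := pow_unbounded_of_one_lt (4 * Λ) (one_lt_two : (1 : ℝ) < 2)
  obtain ⟨ι, hι, u, q0, hcard, hq0N, hq00, hq0p, hzq, huN, huu, huz, huo⟩ :=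
    copies hN m (star z * z) (mul_mem hzs hzN)
        ⟨IsSelfAdjoint.star_mul_self z, by rw [IsIdempotentElem, mul_assoc, hz]⟩
        (fun h => hz0 ((CStarRing.star_mul_self_eq_zero_iff z).1 h))
  have hqz0 : q0 * (star z * z) = q0 := by
    have := congrArg star hzq
    simpa [hq0p.1.star_eq] using this
  have hr : z * q0 * star z = 0 := by
    refine claim_core hτ hNM hE hΛ1 hΛ hx hf (mul_mem hy (hNM hsN)) hqN
      (mul_mem (mul_mem hzN hq0N) hzs) hh hfp ⟨?_, ?_⟩ hxf hxx hlow ?_ ?_ ?_ ?_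
      (n := fun i => z * u i) (ι := ι) ?_ ?_ ?_ ?_ ?_
    · rw [IsSelfAdjoint, star_mul, star_mul, star_star, hq0p.1.star_eq, mul_assoc]
    · calc z * q0 * star z * (z * q0 * star z) = z * (q0 * (star z * z) * q0) * star z := by
            simp only [mul_assoc]
        _ = _ := by rw [hqz0, hq0p.2.eq]
    · rw [← mul_assoc, hhy]
    · rw [← hsas, hb, ← hE.bimod s hsN _ hyy s hsN, star_mul _ s, hs.star_eq]
      simp only [mul_assoc]
    · rw [← mul_assoc, E_right hE hsN (mul_mem hxs hy), hxy, zero_mul]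
    · rw [← mul_assoc, ← mul_assoc, hqz]
    · rw [hcard]; push_cast; exact hm.le
    · intro i; exact mul_mem hzN (huN i)
    · intro i
      show z * u i * star (z * u i) = _
      rw [star_mul, ← huu i]; simp only [mul_assoc]
    · intro i j hij
      show z * u i * star (z * u j) = 0
      rw [star_mul]
      calc z * u i * (star (u j) * star z) = z * (u i * star (u j)) * star z := by
            simp only [mul_assoc]
        _ = 0 := by rw [huo i j hij]; simp
    · intro i
      show z * u i * f = z * u i
      rw [← huz i, mul_assoc, mul_assoc, mul_assoc (star z), hzf]
  apply hq00
  calc q0 = (star z * z) * q0 * (star z * z) := by rw [hzq, hqz0]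
    _ = star z * (z * q0 * star z) * z := by simp only [mul_assoc]
    _ = 0 := by rw [hr]; simp

lemma back (hM : IsII1Factor M τ) (hN : IsII1Factor N τ)
    (hNM : (N : Set (Op H)) ⊆ (M : Set (Op H)))
    (hE : IsCondExp τ (M : Set (Op H)) (N : Set (Op H)) E)
    (hfin : HasFiniteIndex (M : Set (Op H)) E) :
    CornerEmbeds (M : Set (Op H)) (N : Set (Op H)) (M : Set (Op H)) := by
  have hτ := hM.trace
  obtain ⟨Λ, hΛ1, hΛ, hopt⟩ := exists_sup hτ hE hfin
  obtain ⟨h, hhM, x, hx, f, hf, hh, hh0, hfp, hhx, hxf, hxx, hlow⟩ :=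
    exists_hx hτ hNM hE hΛ1 hΛ hopt
  have hxs : star x ∈ M := star_mem (s := M) hx
  obtain ⟨ζ, hζ⟩ : ∃ ζ, h ζ ≠ 0 := by
    by_contra hcon
    push Not at hcon
    exact hh0 (by ext ξ; exact hcon ξ)
  have hhζ : h (h ζ) = h ζ := by rw [← mul_ap, hh.2.eq]
  have hζn : 0 < ‖h ζ‖ ^ 2 := by
    have := norm_pos_iff.2 hζ
    positivity
  have hζx : 0 < ‖(star x) (h ζ)‖ ^ 2 := by
    have := hlow _ hhζ
    nlinarith
  have hx0 : x ≠ 0 := by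
    rintro rfl
    simp at hζx
  have hf0 : f ≠ 0 := fun h0 => hx0 (E_faithful hτ hE hx (by rw [hxx, h0]))
  have hfx : f * star x = star x := by
    have := congrArg star hxf
    rwa [star_mul, hfp.1.star_eq] at this
  have hxh : star x * h = star x := by
    have := congrArg star hhx
    rwa [star_mul, hh.1.star_eq] at this
  have key : ∀ y ∈ M, h * y = y → y = x * E (star x * y) := by
    intro y hy hhy
    have hxy := mul_mem hxs hy
    have hEN : E (star x * y) ∈ N := hE.mem _ hxy
    have hm : x * E (star x * y) ∈ M := mul_mem hx (hNM hEN)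
    refine sub_eq_zero.1 (claim hN hτ hNM hE hΛ1 hΛ hx hf (sub_mem hy hm) hh hfp hf0 hxf hxx
      hlow ?_ ?_)
    · rw [mul_sub, hhy, ← mul_assoc, hhx]
    · rw [mul_sub, E_sub hE hxy (mul_mem hxs hm), ← mul_assoc (star x) x,
        E_right hE hEN (mul_mem hxs hx), hxx, ← E_left hE hf hxy, ← mul_assoc f, hfx, sub_self]
  have hcor : ∀ a ∈ corner h (M : Set (Op H)), a ∈ M ∧ h * a = a ∧ a * h = a := by
    rintro a ⟨ha, hha⟩
    refine ⟨ha, ?_, ?_⟩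
    · rw [← hha, ← mul_assoc, ← mul_assoc, hh.2.eq]
    · rw [← hha, mul_assoc, hh.2.eq]
  have hcors : ∀ a ∈ corner h (M : Set (Op H)), star a ∈ corner h (M : Set (Op H)) := by
    intro a ha
    refine ⟨star_mem (s := M) ha.1, ?_⟩
    have := congrArg star ha.2
    simpa [hh.1.star_eq, mul_assoc] using this
  have hmem : ∀ a ∈ M, star x * a * x ∈ M := fun a ha => mul_mem (mul_mem hxs ha) hx
  have hax : ∀ a ∈ corner h (M : Set (Op H)), a * x = x * E (star x * a * x) := by
    intro a ha
    obtain ⟨haM, h1, h2⟩ := hcor a ha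
    have := key (a * x) (mul_mem haM hx) (by rw [← mul_assoc, h1])
    rwa [← mul_assoc] at this
  have hθs : ∀ a ∈ M, E (star x * star a * x) = star (E (star x * a * x)) := by
    intro a ha
    rw [← E_star hτ hNM hE (hmem a ha)]
    simp [mul_assoc]
  have hxa : ∀ a ∈ corner h (M : Set (Op H)), E (star x * a * x) * star x = star x * a := by
    intro a ha
    have h1 := congrArg star (hax _ (hcors a ha))
    rw [hθs a ha.1] at h1
    simpa using h1.symm
  obtain ⟨l, hl⟩ := corner_center hM.factor hτ hhM hh hh0 (z := x * star x) (mul_mem hx hxs)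
    (by rw [← mul_assoc, hhx, mul_assoc, hxh]) (by
      intro a ha
      rw [← mul_assoc, hax a ha, mul_assoc, hxa a ha, mul_assoc])
  have hlim : l = (l.re : ℂ) := by
    have h1 := congrArg star hl
    rw [star_smul, hh.1.star_eq, star_mul, star_star, hl] at h1
    have h2 : (l - star l) • h = 0 := by rw [sub_smul, h1, sub_self]
    rcases smul_eq_zero.1 h2 with h3 | h3
    · have h4 : (starRingEnd ℂ) l = l := (sub_eq_zero.1 h3).symm
      exact (Complex.conj_eq_iff_re.1 h4).symm
    · exact absurd h3 hh0
  obtain ⟨t, ht⟩ : ∃ t : ℝ, t = l.re := ⟨_, rfl⟩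
  rw [← ht] at hlim
  rw [hlim] at hl
  have htpos : 0 < t := by
    have e := re_inner_star_mul (star x) (h ζ)
    rw [star_star, hl, Complex.coe_smul, rsmul_inner, hhζ] at e
    have e2 := proj_form hh (h ζ)
    rw [hhζ] at e2
    rw [e2] at e
    rw [← e] at hζx
    exact pos_of_mul_pos_left hζx hζn.le
  obtain ⟨m, hm, hmm⟩ : ∃ m : ℝ, 0 < m ∧ m * m * t = 1 := by
    refine ⟨(Real.sqrt t)⁻¹, inv_pos.2 (Real.sqrt_pos.2 htpos), ?_⟩
    rw [← mul_inv, Real.mul_self_sqrt htpos.le, inv_mul_cancel₀ htpos.ne']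
  refine ⟨h, f, (m : ℂ) • star x, fun a => E (star x * a * x), hhM, hh, hh0, hf, hfp, hf0,
    ⟨?_, ?_, ?_, ?_, ?_⟩, smul_mem' M _ hxs, ?_, ?_, ?_, ?_⟩
  · intro a ha
    refine ⟨hE.mem _ (hmem a ha.1), ?_⟩
    show f * E (star x * a * x) * f = E (star x * a * x)
    rw [← hE.bimod f hf _ (hmem a ha.1) f hf]
    congr 1
    calc f * (star x * a * x) * f = (f * star x) * a * (x * f) := by simp only [mul_assoc]
      _ = _ := by rw [hfx, hxf]
  · intro a ha b hb
    show E (star x * (a + b) * x) = _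
    rw [mul_add, add_mul, hE.map_add _ (hmem a ha.1) _ (hmem b hb.1)]
  · intro a ha b hb
    show E (star x * (a * b) * x) = E (star x * a * x) * E (star x * b * x)
    rw [← E_right hE (hE.mem _ (hmem b hb.1)) (hmem a ha.1)]
    congr 1
    rw [mul_assoc (star x * a) x, ← hax b hb]
    simp only [mul_assoc]
  · intro c a ha
    show E (star x * (c • a) * x) = c • E (star x * a * x)
    rw [← hE.map_smul c _ (hmem a ha.1)]
    simp
  · intro a ha
    exact hθs a ha.1
  · intro h0
    rcases smul_eq_zero.1 h0 with h1 | h1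
    · exact hm.ne' (by exact_mod_cast h1)
    · exact hx0 (by simpa using h1)
  · have e : star ((m : ℂ) • star x) * ((m : ℂ) • star x) = h := by
      rw [star_smul, star_star, smul_mul_smul_comm, hl, smul_smul]
      have : star (m : ℂ) * (m : ℂ) * (t : ℂ) = 1 := by
        have h1 : star (m : ℂ) = (m : ℂ) := Complex.conj_ofReal m
        rw [h1]; exact_mod_cast hmm
      rw [this, one_smul]
    rw [e]; exact hh
  · rw [mul_smul_comm, smul_mul_assoc, hfx, hxh]
  · intro a ha
    show E (star x * a * x) * ((m : ℂ) • star x) = (m : ℂ) • star x * a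
    rw [mul_smul_comm, hxa a ha, smul_mul_assoc]

end Back2

/-- Proposition 2.3. Let `N ⊆ M` be II₁ factors with `N' ∩ M = ℂ1`,
and let `E_N` be the trace-preserving conditional expectation of `M` onto `N`.
Then a corner of `M` embeds into `N` inside `M` if and only if the Jones index
`[M : N]` is finite. -/
theorem cornerEmbeds_iff_finiteIndex
    {H : Type u} [NormedAddCommGroup H] [InnerProductSpace ℂ H] [CompleteSpace H]
    (M N : VonNeumannAlgebra H) (τ : Op H →ₗ[ℂ] ℂ) (EN : Op H → Op H)
    (hM : IsII1Factor M τ) (hN : IsII1Factor N τ)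
    (hNM : (N : Set (Op H)) ⊆ (M : Set (Op H)))
    (hirr : relComm (N : Set (Op H)) (M : Set (Op H)) = scalars H)
    (hE : IsCondExp τ (M : Set (Op H)) (N : Set (Op H)) EN) :
    CornerEmbeds (M : Set (Op H)) (N : Set (Op H)) (M : Set (Op H)) ↔
      HasFiniteIndex (M : Set (Op H)) EN := by
  exact ⟨fwd hM.factor hM.trace hNM hirr hE, back hM hN hNM hE⟩

end PopaQ
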